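/- arXiv:0704.2560 — 2 statements merged into one kernel-verified Lean document; each statement's English description precedes it below -/
import Mathlib

section
/- (Exponential bound on containing a low-dimensional set.) Let d ≥ 4 and 1 ≤ m ≤ d−3, and let λ > 0 satisfy χ(λ) := e^λ·(m/d + (1 − m/d)·q(d−m)) < 1. Then there exists u₁ = u₁(d,m,λ) > 0 such that for all 0 ≤ u ≤ u₁, every A ∈ 𝒜_m, and every vacant-set law Q at level u on {0,1}^{ℤ^d}: Q[Y_z = 0 for all z ∈ A] ≤ exp(−λ·|A|), where |A| is the cardinality of A. -/
open MeasureTheory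
open scoped ENNReal

abbrev Zd (d : ℕ) := Fin d → ℤ

/-- Nearest-neighbor adjacency on `ℤ^d`. -/
def adj {d : ℕ} (x y : Zd d) : Prop := (∑ i, (x i - y i).natAbs) = 1

instance {d : ℕ} (x y : Zd d) : Decidable (adj x y) := by
  unfold adj; infer_instance

/-- `P` is the family of laws of simple random walk on `ℤ^d`, characterized by its
finite-dimensional (cylinder) distributions. -/
def IsSRW (d : ℕ) (P : Zd d → Measure (ℕ → Zd d)) : Prop :=
  (∀ x, IsProbabilityMeasure (P x)) ∧
  ∀ (x : Zd d) (N : ℕ) (γ : ℕ → Zd d), γ 0 = x →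
    P x {w | ∀ k ≤ N, w k = γ k} =
      if ∀ k < N, adj (γ (k + 1)) (γ k) then ((2 * d : ℝ≥0∞))⁻¹ ^ N else 0

/-- The event `{H̃_K = ∞}`. -/
def escSet (d : ℕ) (K : Finset (Zd d)) : Set (ℕ → Zd d) :=
  {ω | ∀ n : ℕ, 1 ≤ n → ω n ∉ K}

/-- The equilibrium measure `e_K`. -/
noncomputable def eqm (d : ℕ) (P : Zd d → Measure (ℕ → Zd d)) (K : Finset (Zd d))
    (x : Zd d) : ℝ≥0∞ :=
  if x ∈ K then P x (escSet d K) else 0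

/-- The capacity `cap(K) = Σ_x e_K(x)`. -/
noncomputable def capa (d : ℕ) (P : Zd d → Measure (ℕ → Zd d)) (K : Finset (Zd d)) : ℝ≥0∞ :=
  ∑ x ∈ K, eqm d P K x

/-- `Q` is a vacant-set law at level `u`:
`Q[Y_z = 1 for z ∈ K] = exp(−u·cap(K))` for every finite `K`. -/
def IsVacantLaw (d : ℕ) (P : Zd d → Measure (ℕ → Zd d)) (u : ℝ)
    (Q : Measure (Zd d → Bool)) : Prop :=
  IsProbabilityMeasure Q ∧
  ∀ K : Finset (Zd d),
    Q {ω | ∀ z ∈ K, ω z = true} = ENNReal.ofReal (Real.exp (-(u * (capa d P K).toReal)))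

/-- The return probability `q(ν)` of simple random walk on `ℤ^ν`. -/
noncomputable def retProb (ν : ℕ) (Pν : Zd ν → Measure (ℕ → Zd ν)) : ℝ :=
  (Pν 0 {w : ℕ → Zd ν | ∃ n : ℕ, 1 ≤ n ∧ w n = 0}).toReal

/-- `χ(λ) = e^λ (m/d + (1 − m/d) q(d−m))`. -/
noncomputable def chiVal (d m : ℕ) (q lam : ℝ) : ℝ :=
  Real.exp lam * ((m : ℝ) / d + (1 - (m : ℝ) / d) * q)

lemma moebius_bound {α : Type*} [DecidableEq α] (A : Finset α) (a : Finset α → ℝ)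
    (ha : ∀ S, 0 ≤ a S) (t : ℝ) (ht : 1 ≤ t) :
    ∑ K ∈ A.powerset, (-1 : ℝ) ^ K.card *
      Real.exp (-(∑ S ∈ A.powerset, a S * (if Disjoint S K then 0 else 1)))
    ≤ (t ^ A.card)⁻¹ * Real.exp (∑ S ∈ A.powerset, a S * t ^ S.card) := by
  classical
  have ht0 : 0 < t := by linarith
  set W : Finset (Finset α) → ℝ := fun T =>
    (∏ S ∈ T, (1 - Real.exp (-a S))) * ∏ S ∈ A.powerset \ T, Real.exp (-a S) with hW
  have hW0 : ∀ T, 0 ≤ W T := by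
    intro T
    apply mul_nonneg
    · apply Finset.prod_nonneg
      intro S _
      have := Real.exp_le_one_iff.mpr (neg_nonpos.mpr (ha S))
      linarith
    · exact Finset.prod_nonneg fun S _ => (Real.exp_pos _).le
  have h1 : ∀ K : Finset α,
      Real.exp (-(∑ S ∈ A.powerset, a S * (if Disjoint S K then 0 else 1))) =
      ∑ T ∈ A.powerset.powerset, W T * (if Disjoint (T.sup id) K then 1 else 0) := by
    intro K
    rw [← Finset.sum_neg_distrib, Real.exp_sum]
    have : ∀ S ∈ A.powerset, Real.exp (-(a S * (if Disjoint S K then 0 else 1))) =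
        (1 - Real.exp (-a S)) * (if Disjoint S K then 1 else 0) + Real.exp (-a S) := by
      intro S _
      split_ifs <;> simp
    rw [Finset.prod_congr rfl this, Finset.prod_add]
    refine Finset.sum_congr rfl fun T _ => ?_
    rw [Finset.prod_mul_distrib, Finset.prod_boole]
    have e : (∀ i ∈ T, Disjoint i K) ↔ Disjoint (T.sup id) K := by
      rw [Finset.disjoint_sup_left]; rfl
    simp only [hW, e]
    ring
  have h2 : ∀ T ∈ A.powerset.powerset,
      ∑ K ∈ A.powerset, (-1 : ℝ) ^ K.card * (if Disjoint (T.sup id) K then 1 else 0)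
      = if A \ T.sup id = ∅ then 1 else 0 := by
    intro T _
    have := Finset.sum_powerset_neg_one_pow_card (x := A \ T.sup id)
    have h3 : ((∑ K ∈ (A \ T.sup id).powerset, (-1 : ℤ) ^ K.card : ℤ) : ℝ)
      = if A \ T.sup id = ∅ then 1 else 0 := by
      rw [this]; split_ifs <;> simp
    rw [← h3]
    push_cast
    simp only [mul_ite, mul_one, mul_zero]
    rw [← Finset.sum_filter]
    apply Finset.sum_congr _ fun _ _ => rfl
    ext K
    simp only [Finset.mem_filter, Finset.mem_powerset, Finset.subset_sdiff]
    rw [disjoint_comm]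
  have h3 : ∑ K ∈ A.powerset, (-1 : ℝ) ^ K.card *
      Real.exp (-(∑ S ∈ A.powerset, a S * (if Disjoint S K then 0 else 1)))
      = ∑ T ∈ A.powerset.powerset, W T * (if A \ T.sup id = ∅ then 1 else 0) := by
    simp_rw [h1, Finset.mul_sum]
    rw [Finset.sum_comm]
    refine Finset.sum_congr rfl fun T hT => ?_
    rw [← h2 T hT, Finset.mul_sum]
    refine Finset.sum_congr rfl fun K _ => ?_
    ring
  rw [h3]
  have h4 : ∀ T ∈ A.powerset.powerset, W T * (if A \ T.sup id = ∅ then 1 else 0)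
      ≤ (t ^ A.card)⁻¹ * (W T * ∏ S ∈ T, t ^ S.card) := by
    intro T _
    have hp : 0 ≤ ∏ S ∈ T, t ^ S.card := Finset.prod_nonneg fun _ _ => by positivity
    split_ifs with h
    · have hc : A.card ≤ ∑ S ∈ T, S.card := by
        rw [Finset.sdiff_eq_empty_iff_subset, Finset.sup_eq_biUnion] at h
        exact (Finset.card_le_card h).trans Finset.card_biUnion_le
      rw [Finset.prod_pow_eq_pow_sum]
      have h5 : 1 ≤ (t ^ A.card)⁻¹ * t ^ (∑ S ∈ T, S.card) := by
        rw [← div_eq_inv_mul, one_le_div (by positivity)]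
        exact pow_le_pow_right₀ ht hc
      calc W T * 1 ≤ W T * ((t ^ A.card)⁻¹ * t ^ (∑ S ∈ T, S.card)) :=
            mul_le_mul_of_nonneg_left h5 (hW0 T)
        _ = _ := by ring
    · rw [mul_zero]
      have := hW0 T
      positivity
  refine (Finset.sum_le_sum h4).trans ?_
  rw [← Finset.mul_sum]
  apply mul_le_mul_of_nonneg_left _ (by positivity)
  have h6 : ∑ T ∈ A.powerset.powerset, W T * ∏ S ∈ T, t ^ S.card
      = ∏ S ∈ A.powerset, ((1 - Real.exp (-a S)) * t ^ S.card + Real.exp (-a S)) := by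
    rw [Finset.prod_add]
    refine Finset.sum_congr rfl fun T _ => ?_
    rw [Finset.prod_mul_distrib]
    simp only [hW]; ring
  rw [h6, Real.exp_sum]
  apply Finset.prod_le_prod
  · intro S _
    have := Real.exp_le_one_iff.mpr (neg_nonpos.mpr (ha S))
    have h7 : 0 ≤ 1 - Real.exp (-a S) := by linarith
    positivity
  · intro S _
    have := Real.exp_le_one_iff.mpr (neg_nonpos.mpr (ha S))
    have h7 : 1 - Real.exp (-a S) ≤ a S := by have := Real.add_one_le_exp (-a S); linarith
    have h8 : 0 < t ^ S.card := by positivity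
    have h9 := Real.add_one_le_exp (a S * t ^ S.card)
    nlinarith

lemma incl_excl {d : ℕ} (Q : Measure (Zd d → Bool)) [IsProbabilityMeasure Q] (A : Finset (Zd d)) :
    Q.real {ω | ∀ z ∈ A, ω z = false} =
      ∑ K ∈ A.powerset, (-1 : ℝ) ^ K.card * Q.real {ω | ∀ z ∈ K, ω z = true} := by
  classical
  have hm : ∀ (K : Finset (Zd d)) (b : Bool), MeasurableSet {ω : Zd d → Bool | ∀ z ∈ K, ω z = b} := by
    intro K b
    have : {ω : Zd d → Bool | ∀ z ∈ K, ω z = b} = ⋂ z ∈ K, (fun ω => ω z) ⁻¹' {b} := by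
      ext; simp
    rw [this]
    exact Finset.measurableSet_biInter _ fun z _ => measurable_pi_apply z (MeasurableSet.singleton b)
  rw [← integral_indicator_one (hm A false)]
  have : ∀ K : Finset (Zd d), Q.real {ω | ∀ z ∈ K, ω z = true} =
    ∫ ω, ({ω | ∀ z ∈ K, ω z = true} : Set (Zd d → Bool)).indicator 1 ω ∂Q := fun K =>
      (integral_indicator_one (hm K true)).symm
  simp_rw [this, ← integral_const_mul]
  rw [← integral_finsetSum]
  · congr 1
    ext ω
    have e1 : ({ω | ∀ z ∈ A, ω z = false} : Set (Zd d → Bool)).indicator (1 : (Zd d → Bool) → ℝ) ω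
      = ∏ z ∈ A, ((-(if ω z = true then 1 else 0)) + 1) := by
      simp only [Set.indicator_apply, Set.mem_ofPred_eq, Pi.one_apply]
      rw [← Finset.prod_boole]
      refine Finset.prod_congr rfl fun z _ => ?_
      cases ω z <;> simp
    rw [e1, Finset.prod_add]
    refine Finset.sum_congr rfl fun K _ => ?_
    simp only [Finset.prod_const_one, mul_one, Finset.prod_neg, Finset.prod_boole, Set.indicator_apply, Set.mem_ofPred_eq, Pi.one_apply]
  · intro K _
    exact ((integrable_const (1:ℝ)).indicator (hm K true)).const_mul _

def stp (d : ℕ) (j : Fin d × Bool) : Zd d := Pi.single j.1 (if j.2 then 1 else -1)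

lemma stp_inj (d : ℕ) : Function.Injective (stp d) := by
  rintro ⟨i, s⟩ ⟨i', s'⟩ h
  have h1 := congrFun h i
  have h2 := congrFun h i'
  by_cases hi : i = i'
  · subst hi
    cases s <;> cases s' <;> simp [stp] at h1 ⊢
  · exfalso
    simp only [stp, Pi.single_apply, hi, if_true, if_false] at h1
    split_ifs at h1 <;> simp at h1

lemma adj_iff {d : ℕ} (z x : Zd d) : adj z x ↔ ∃ j, z = x + stp d j := by
  unfold adj
  constructor
  · intro h
    obtain ⟨i, hi⟩ : ∃ i, (z i - x i).natAbs ≠ 0 := by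
      by_contra! hc
      simp [hc] at h
    rw [← Finset.add_sum_erase _ _ (Finset.mem_univ i)] at h
    have h0 : ∑ k ∈ Finset.univ.erase i, (z k - x k).natAbs = 0 := by omega
    rw [Finset.sum_eq_zero_iff] at h0
    have h1 : (z i - x i).natAbs = 1 := by omega
    have h2 : z i - x i = 1 ∨ z i - x i = -1 := by omega
    have key : ∀ s : Bool, z i - x i = (if s then 1 else -1) → z = x + stp d (i, s) := by
      intro s hs
      ext k
      by_cases hk : k = i
      · subst hk; simp only [stp, Pi.add_apply, Pi.single_eq_same]; omega
      · have := h0 k (by simp [hk])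
        simp [stp, Pi.single_apply, hk]; omega
    rcases h2 with h2 | h2
    · exact ⟨(i, true), key _ (by simpa using h2)⟩
    · exact ⟨(i, false), key _ (by simpa using h2)⟩
  · rintro ⟨⟨i, s⟩, rfl⟩
    rw [Finset.sum_eq_single i]
    · cases s <;> simp [stp]
    · intro k _ hk; simp [stp, hk]
    · simp

lemma sum_stp_ite {d : ℕ} (z x : Zd d) (c : ℝ≥0∞) :
    ∑ j, (if z = x + stp d j then c else 0) = if adj z x then c else 0 := by
  classical
  split_ifs with h
  · obtain ⟨j, hj⟩ := (adj_iff z x).1 h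
    rw [Finset.sum_eq_single j]
    · rw [if_pos hj]
    · intro k _ hk
      rw [if_neg]
      intro h'
      exact hk (stp_inj d (add_left_cancel (h'.symm.trans hj)))
    · simp
  · apply Finset.sum_eq_zero
    intro j _
    rw [if_neg]
    intro h'
    exact h ((adj_iff z x).2 ⟨j, h'⟩)

def pcons {d : ℕ} (x : Zd d) (w : ℕ → Zd d) : ℕ → Zd d
  | 0 => x
  | n + 1 => w n

@[simp] lemma pcons_zero {d : ℕ} (x : Zd d) (w) : pcons x w 0 = x := rfl
@[simp] lemma pcons_succ {d : ℕ} (x : Zd d) (w) (n) : pcons x w (n+1) = w n := rfl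

lemma measurable_pcons {d : ℕ} (x : Zd d) : Measurable (pcons x) := by
  apply measurable_pi_lambda
  rintro (_ | n)
  · exact measurable_const
  · exact measurable_pi_apply n

def cyl {d : ℕ} (N : ℕ) (γ : ℕ → Zd d) : Set (ℕ → Zd d) := {w | ∀ k ≤ N, w k = γ k}

lemma meas_eq {d : ℕ} (k : ℕ) (z : Zd d) : MeasurableSet {w : ℕ → Zd d | w k = z} :=
  (measurable_pi_apply k : Measurable fun w : ℕ → Zd d => w k) (MeasurableSet.singleton z)

lemma meas_mem {d : ℕ} (k : ℕ) (S : Set (Zd d)) : MeasurableSet {w : ℕ → Zd d | w k ∈ S} :=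
  (measurable_pi_apply k : Measurable fun w : ℕ → Zd d => w k) (Set.to_countable S).measurableSet

lemma meas_cyl {d : ℕ} (N : ℕ) (γ : ℕ → Zd d) : MeasurableSet (cyl N γ) := by
  unfold cyl
  simp only [Set.ofPred_forall]
  exact MeasurableSet.iInter fun k => MeasurableSet.iInter fun _ => meas_eq k _

lemma cyl_pi {d : ℕ} : IsPiSystem {s : Set (ℕ → Zd d) | ∃ N γ, s = cyl N γ} := by
  rintro _ ⟨N, γ, rfl⟩ _ ⟨N', γ', rfl⟩ ⟨w, hw, hw'⟩
  refine ⟨max N N', w, ?_⟩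
  ext v
  constructor
  · rintro ⟨h1, h2⟩ k hk
    rcases le_max_iff.1 hk with h | h
    · rw [h1 k h, hw k h]
    · rw [h2 k h, hw' k h]
  · intro h
    exact ⟨fun k hk => (h k (le_max_of_le_left hk)).trans (hw k hk),
      fun k hk => (h k (le_max_of_le_right hk)).trans (hw' k hk)⟩

lemma cyl_gen {d : ℕ} : (inferInstance : MeasurableSpace (ℕ → Zd d)) =
    MeasurableSpace.generateFrom {s : Set (ℕ → Zd d) | ∃ N γ, s = cyl N γ} := by
  apply le_antisymm
  · show MeasurableSpace.pi ≤ _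
    unfold MeasurableSpace.pi
    refine iSup_le fun k => ?_
    rintro _ ⟨S, hS, rfl⟩
    have : (fun b : ℕ → Zd d => b k) ⁻¹' S =
      ⋃ p : {p : Fin (k+1) → Zd d // p (Fin.last k) ∈ S},
        cyl k (fun n => if h : n < k + 1 then p.1 ⟨n, h⟩ else 0) := by
      ext w
      simp only [Set.mem_preimage, Set.mem_iUnion]
      constructor
      · intro h
        refine ⟨⟨fun n => w n, by simpa using h⟩, ?_⟩
        intro n hn
        show _ = dite _ _ _
        rw [dif_pos (by omega)]
      · rintro ⟨p, hp⟩
        have : w k = dite _ _ _ := hp k le_rfl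
        rw [dif_pos (by omega)] at this
        rw [this]; exact p.2
    rw [this]
    apply MeasurableSet.iUnion
    intro p
    exact MeasurableSpace.measurableSet_generateFrom ⟨_, _, rfl⟩
  · apply MeasurableSpace.generateFrom_le
    rintro _ ⟨N, γ, rfl⟩
    exact meas_cyl N γ

lemma start_ae {d : ℕ} {P : Zd d → Measure (ℕ → Zd d)} (hP : IsSRW d P) (x : Zd d) :
    P x {w | w 0 ≠ x} = 0 := by
  have := hP.1 x
  have h := hP.2 x 0 (fun _ => x) rfl
  simp at h
  have : {w : ℕ → Zd d | w 0 ≠ x} = {w | w 0 = x}ᶜ := rfl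
  rw [this, prob_compl_eq_zero_iff (meas_eq 0 x)]
  exact h

lemma srw_cyl {d : ℕ} {P : Zd d → Measure (ℕ → Zd d)} (hP : IsSRW d P) (x : Zd d)
    (N : ℕ) (γ : ℕ → Zd d) :
    P x (cyl N γ) = if γ 0 = x then
      (if ∀ k < N, adj (γ (k + 1)) (γ k) then ((2 * d : ℝ≥0∞))⁻¹ ^ N else 0) else 0 := by
  split_ifs with h h'
  · unfold cyl; rw [hP.2 x N γ h, if_pos h']
  · unfold cyl; rw [hP.2 x N γ h, if_neg h']
  · apply measure_mono_null _ (start_ae hP x)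
    intro w hw
    have := hw 0 (Nat.zero_le _)
    simp only [Set.mem_ofPred_eq, this]; exact h

lemma two_d_ne {d : ℕ} (hd : 0 < d) : (2 * d : ℝ≥0∞) ≠ 0 := by
  simp; omega

lemma two_d_top {d : ℕ} : (2 * d : ℝ≥0∞) ≠ ⊤ := by
  exact ENNReal.mul_ne_top (by simp) (by simp)

lemma one_step {d : ℕ} (hd : 0 < d) {P : Zd d → Measure (ℕ → Zd d)} (hP : IsSRW d P) (x : Zd d) :
    P x = (2 * d : ℝ≥0∞)⁻¹ • ∑ j, (P (x + stp d j)).map (pcons x) := by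
  have := hP.1 x
  have ap : ∀ s, MeasurableSet s → ((2 * d : ℝ≥0∞)⁻¹ • ∑ j, (P (x + stp d j)).map (pcons x)) s
    = (2 * d : ℝ≥0∞)⁻¹ * ∑ j, P (x + stp d j) (pcons x ⁻¹' s) := by
    intro s hs
    simp only [Measure.smul_apply, Measure.finsetSum_apply, smul_eq_mul]
    congr 1
    refine Finset.sum_congr rfl fun j _ => ?_
    rw [Measure.map_apply (measurable_pcons x) hs]
  have one : (2 * d : ℝ≥0∞)⁻¹ * ∑ j : Fin d × Bool, 1 = 1 := by
    simp only [Finset.sum_const, Finset.card_univ, Fintype.card_prod, Fintype.card_fin, Fintype.card_bool]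
    rw [nsmul_eq_mul, mul_one, mul_comm d 2]
    push_cast
    exact ENNReal.inv_mul_cancel (two_d_ne hd) two_d_top
  refine ext_of_generate_finite _ cyl_gen cyl_pi ?_ ?_
  · rintro _ ⟨N, γ, rfl⟩
    rw [ap _ (meas_cyl N γ)]
    rw [srw_cyl hP]
    by_cases h0 : γ 0 = x
    · rw [if_pos h0]
      rcases N with _ | N
      · simp only [Nat.not_lt_zero, IsEmpty.forall_iff, implies_true, if_true, pow_zero]
        rw [← one]
        congr 1
        refine Finset.sum_congr rfl fun j _ => ?_
        have := hP.1 (x + stp d j)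
        have : pcons x ⁻¹' cyl 0 γ = Set.univ := by
          ext w; simp [cyl, h0]
        rw [this, measure_univ]
      · have e : ∀ j, P (x + stp d j) (pcons x ⁻¹' cyl (N+1) γ) =
          if γ 1 = x + stp d j then (if ∀ k < N, adj (γ (k + 1 + 1)) (γ (k+1)) then ((2 * d : ℝ≥0∞))⁻¹ ^ N else 0) else 0 := by
          intro j
          have : pcons x ⁻¹' cyl (N+1) γ = cyl N (fun n => γ (n+1)) := by
            ext w
            simp only [cyl, Set.mem_preimage, Set.mem_ofPred_eq]
            constructor
            · intro h k hk
              exact h (k+1) (by omega)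
            · rintro h (_ | k) hk
              · exact h0.symm
              · exact h k (by omega)
          rw [this, srw_cyl hP]
        simp_rw [e]
        rw [sum_stp_ite, ← h0]
        by_cases h1 : adj (γ 1) (γ 0)
        · rw [if_pos h1]
          by_cases h2 : ∀ k < N, adj (γ (k + 1 + 1)) (γ (k+1))
          · rw [if_pos h2, if_pos, pow_succ']
            rintro (_ | k) hk
            · exact h1
            · exact h2 k (by omega)
          · rw [if_neg h2, if_neg, mul_zero]
            intro h; exact h2 fun k hk => h (k+1) (by omega)
        · rw [if_neg h1, if_neg, mul_zero]
          intro h; exact h1 (h 0 (by omega))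
    · rw [if_neg h0]
      symm
      rw [Finset.sum_eq_zero, mul_zero]
      intro j _
      have : pcons x ⁻¹' cyl N γ = ∅ := by
        ext w
        simp only [Set.mem_preimage, Set.mem_empty_iff_false, iff_false]
        intro h
        exact h0 (h 0 (by omega)).symm
      rw [this, measure_empty]
  · rw [ap _ MeasurableSet.univ, measure_univ, ← one]
    congr 1
    refine Finset.sum_congr rfl fun j _ => ?_
    have := hP.1 (x + stp d j)
    simp

noncomputable def avg {d : ℕ} (f : Zd d → ℝ≥0∞) (x : Zd d) : ℝ≥0∞ :=
  (2 * d : ℝ≥0∞)⁻¹ * ∑ j, f (x + stp d j)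

lemma one_step_set {d : ℕ} (hd : 0 < d) {P : Zd d → Measure (ℕ → Zd d)} (hP : IsSRW d P)
    (x : Zd d) {E : Set (ℕ → Zd d)} (hE : MeasurableSet E) :
    P x E = avg (fun z => P z (pcons x ⁻¹' E)) x := by
  conv_lhs => rw [one_step hd hP x]
  simp only [Measure.smul_apply, Measure.finsetSum_apply, smul_eq_mul, avg]
  congr 1
  refine Finset.sum_congr rfl fun j _ => ?_
  rw [Measure.map_apply (measurable_pcons x) hE]

lemma one_step_int {d : ℕ} (hd : 0 < d) {P : Zd d → Measure (ℕ → Zd d)} (hP : IsSRW d P)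
    (x : Zd d) {f : (ℕ → Zd d) → ℝ≥0∞} (hf : Measurable f) :
    ∫⁻ w, f w ∂(P x) = avg (fun z => ∫⁻ w, f (pcons x w) ∂(P z)) x := by
  conv_lhs => rw [one_step hd hP x]
  rw [lintegral_smul_measure, lintegral_finsetSum_measure, smul_eq_mul, avg]
  congr 1
  refine Finset.sum_congr rfl fun j _ => ?_
  rw [lintegral_map hf (measurable_pcons x)]

lemma avg_mono {d : ℕ} {f g : Zd d → ℝ≥0∞} (h : ∀ z, f z ≤ g z) (x : Zd d) : avg f x ≤ avg g x := by
  unfold avg; gcongr; exact h _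

lemma avg_const {d : ℕ} (hd : 0 < d) (c : ℝ≥0∞) (x : Zd d) : avg (fun _ => c) x = c := by
  unfold avg
  simp only [Finset.sum_const, Finset.card_univ, Fintype.card_prod, Fintype.card_fin, Fintype.card_bool]
  rw [nsmul_eq_mul, mul_comm d 2, ← mul_assoc]
  push_cast
  rw [ENNReal.inv_mul_cancel (two_d_ne hd) two_d_top, one_mul]

lemma avg_add {d : ℕ} (f g : Zd d → ℝ≥0∞) (x : Zd d) :
    avg (fun z => f z + g z) x = avg f x + avg g x := by
  unfold avg; rw [Finset.sum_add_distrib, mul_add]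

lemma avg_mul {d : ℕ} (c : ℝ≥0∞) (f : Zd d → ℝ≥0∞) (x : Zd d) :
    avg (fun z => c * f z) x = c * avg f x := by
  unfold avg; rw [← Finset.mul_sum]; ring

noncomputable def hit (ν : ℕ) (P : Zd ν → Measure (ℕ → Zd ν)) (v : Zd ν) : ℝ≥0∞ :=
  P v {w | ∃ n, w n = 0}

lemma meas_hit (ν : ℕ) : MeasurableSet {w : ℕ → Zd ν | ∃ n, w n = 0} := by
  rw [Set.ofPred_exists]
  exact MeasurableSet.iUnion fun n => meas_eq n 0

lemma hit_zero {ν : ℕ} {P : Zd ν → Measure (ℕ → Zd ν)} (hP : IsSRW ν P) : hit ν P 0 = 1 := by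
  have := hP.1 0
  apply le_antisymm prob_le_one
  have h := hP.2 0 0 (fun _ => 0) rfl
  simp at h
  rw [← h]
  exact measure_mono fun w hw => ⟨0, hw⟩

lemma hit_harm {ν : ℕ} (hν : 0 < ν) {P : Zd ν → Measure (ℕ → Zd ν)} (hP : IsSRW ν P) (v : Zd ν)
    (hv : v ≠ 0) : avg (hit ν P) v = hit ν P v := by
  conv_rhs => rw [hit, one_step_set hν hP v (meas_hit ν)]
  congr 1
  ext z
  unfold hit
  congr 1
  ext w
  simp only [Set.mem_ofPred_eq, Set.mem_preimage]
  constructor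
  · rintro ⟨n, hn⟩; exact ⟨n+1, hn⟩
  · rintro ⟨_ | n, hn⟩
    · exact absurd hn hv
    · exact ⟨n, hn⟩

lemma hit_ret {ν : ℕ} (hν : 0 < ν) {P : Zd ν → Measure (ℕ → Zd ν)} (hP : IsSRW ν P) :
    P 0 {w : ℕ → Zd ν | ∃ n : ℕ, 1 ≤ n ∧ w n = 0} = avg (hit ν P) 0 := by
  have hm : MeasurableSet {w : ℕ → Zd ν | ∃ n : ℕ, 1 ≤ n ∧ w n = 0} := by
    simp only [Set.ofPred_exists, Set.ofPred_and]
    exact MeasurableSet.iUnion fun n => (MeasurableSet.const _).inter (meas_eq n 0)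
  rw [one_step_set hν hP 0 hm]
  congr 1
  ext z
  unfold hit
  congr 1
  ext w
  simp only [Set.mem_ofPred_eq, Set.mem_preimage]
  constructor
  · rintro ⟨_ | n, h1, hn⟩
    · omega
    · exact ⟨n, hn⟩
  · rintro ⟨n, hn⟩; exact ⟨n+1, by omega, hn⟩

def prj {d ν : ℕ} {I : Finset (Fin d)} (e : Fin ν ≃ {i // i ∉ I}) (y x : Zd d) : Zd ν :=
  fun j => x (e j).1 - y (e j).1

lemma prj_zero {d ν : ℕ} {I : Finset (Fin d)} (e : Fin ν ≃ {i // i ∉ I}) (y x : Zd d) :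
    prj e y x = 0 ↔ ∀ i, i ∉ I → x i = y i := by
  constructor
  · intro h i hi
    have := congrFun h (e.symm ⟨i, hi⟩)
    simp [prj] at this
    omega
  · intro h
    ext j
    simp [prj, h _ (e j).2]

lemma prj_in {d ν : ℕ} {I : Finset (Fin d)} (e : Fin ν ≃ {i // i ∉ I}) (y x : Zd d)
    (i : Fin d) (hi : i ∈ I) (s : Bool) : prj e y (x + stp d (i, s)) = prj e y x := by
  ext j
  have : (e j).1 ≠ i := fun h => (e j).2 (h ▸ hi)
  simp [prj, stp, this]

lemma prj_out {d ν : ℕ} {I : Finset (Fin d)} (e : Fin ν ≃ {i // i ∉ I}) (y x : Zd d)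
    (k : Fin ν) (s : Bool) : prj e y (x + stp d ((e k).1, s)) = prj e y x + stp ν (k, s) := by
  ext j
  by_cases h : j = k
  · subst h; simp [prj, stp]; ring
  · have : (e j).1 ≠ (e k).1 := fun h' => h (e.injective (Subtype.ext h'))
    simp [prj, stp, this, h]

lemma avg_prj {d ν : ℕ} (hν : 0 < ν) {I : Finset (Fin d)} (e : Fin ν ≃ {i // i ∉ I}) (y x : Zd d)
    (f : Zd ν → ℝ≥0∞) :
    avg (fun z => f (prj e y z)) x = (2 * d : ℝ≥0∞)⁻¹ *
      (2 * I.card * f (prj e y x) + 2 * ν * avg f (prj e y x)) := by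
  unfold avg
  congr 1
  rw [Fintype.sum_prod_type, ← Fintype.sum_subtype_add_sum_subtype (fun i => i ∈ I)]
  congr 1
  · have : ∀ i : {i // i ∈ I}, ∑ s : Bool, f (prj e y (x + stp d (i.1, s))) = 2 * f (prj e y x) := by
      intro i
      simp only [prj_in e y x i.1 i.2, Finset.sum_const]
      simp
    rw [Finset.sum_congr rfl fun i _ => this i]
    simp
    ring
  · rw [← mul_assoc, ENNReal.mul_inv_cancel (two_d_ne hν) two_d_top, one_mul, Fintype.sum_prod_type,
      ← e.sum_comp]
    simp only [prj_out]

open Classical in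
noncomputable def vis {d : ℕ} (F : Set (Zd d)) (t : ℝ≥0∞) (n : ℕ) (w : ℕ → Zd d) : ℝ≥0∞ :=
  ∏ k ∈ Finset.range n, if w k ∈ F then t else 1

lemma meas_vis {d : ℕ} (F : Set (Zd d)) (t : ℝ≥0∞) (n : ℕ) : Measurable (vis F t n) := by
  unfold vis
  refine Finset.measurable_prod _ fun k _ => ?_
  exact Measurable.ite (meas_mem k F) measurable_const measurable_const

open Classical in
lemma vis_cons {d : ℕ} (F : Set (Zd d)) (t : ℝ≥0∞) (n : ℕ) (x : Zd d) (w : ℕ → Zd d) :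
    vis F t (n+1) (pcons x w) = (if x ∈ F then t else 1) * vis F t n w := by
  unfold vis
  rw [Finset.prod_range_succ', mul_comm]
  rfl

lemma exp_mom {d ν : ℕ} (hd : 0 < d) (hν : 0 < ν) {I : Finset (Fin d)}
    (hI : I.card + ν = d)
    (e : Fin ν ≃ {i // i ∉ I}) (y : Zd d)
    {P : Zd d → Measure (ℕ → Zd d)} (hP : IsSRW d P)
    {Pm : Zd ν → Measure (ℕ → Zd ν)} (hPm : IsSRW ν Pm)
    (t b p : ℝ≥0∞) (htb : t * (1 + b * p) = 1 + b)
    (hp : p = (2 * d : ℝ≥0∞)⁻¹ * (2 * I.card + 2 * ν * avg (hit ν Pm) 0))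
    (n : ℕ) (x : Zd d) :
    ∫⁻ w, vis {z | ∀ i, i ∉ I → z i = y i} t n w ∂(P x) ≤ 1 + b * hit ν Pm (prj e y x) := by
  classical
  set F : Set (Zd d) := {z | ∀ i, i ∉ I → z i = y i} with hF
  have hmem : ∀ z, z ∈ F ↔ prj e y z = 0 := fun z => (prj_zero e y z).symm
  have hav : ∀ x, avg (fun z => 1 + b * hit ν Pm (prj e y z)) x =
      1 + b * avg (fun z => hit ν Pm (prj e y z)) x := by
    intro x; rw [avg_add, avg_const hd, avg_mul]
  induction n generalizing x with
  | zero =>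
    have := hP.1 x
    simp [vis]
  | succ n ih =>
    rw [one_step_int hd hP x (meas_vis F t (n+1))]
    have e1 := vis_cons F t n x
    simp_rw [e1]
    simp_rw [lintegral_const_mul _ (meas_vis F t n)]
    rw [avg_mul]
    refine (mul_le_mul_right (avg_mono ih x) _).trans ?_
    rw [hav, avg_prj hν]
    by_cases hx : x ∈ F
    · rw [if_pos hx, (hmem x).1 hx, hit_zero hPm, mul_one, mul_one, ← hp, htb]
    · rw [if_neg hx, one_mul, hit_harm hν hPm _ (fun h => hx ((hmem x).2 h)), ← add_mul, ← mul_add,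
        ← mul_assoc (2 * (d:ℝ≥0∞))⁻¹]
      have : (I.card + ν : ℝ≥0∞) = d := by exact_mod_cast hI
      rw [this, ENNReal.inv_mul_cancel (two_d_ne hd) two_d_top, one_mul]

lemma vis_mono {d : ℕ} (F : Set (Zd d)) (t : ℝ≥0∞) (ht : 1 ≤ t) (w : ℕ → Zd d) :
    Monotone (fun n => vis F t n w) := by
  classical
  apply monotone_nat_of_le_succ
  intro n
  unfold vis
  rw [Finset.prod_range_succ]
  apply le_mul_of_one_le_right (zero_le)
  split_ifs
  · exact ht
  · exact le_rfl

lemma exp_mom_sup {d : ℕ} (F : Set (Zd d)) (t : ℝ≥0∞) (ht : 1 ≤ t) (μ : Measure (ℕ → Zd d)) (c : ℝ≥0∞)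
    (h : ∀ n, ∫⁻ w, vis F t n w ∂μ ≤ c) : ∫⁻ w, (⨆ n, vis F t n w) ∂μ ≤ c := by
  rw [lintegral_iSup (fun n => meas_vis F t n) (fun i j hij w => vis_mono F t ht w hij)]
  exact iSup_le h

lemma vis_eq {d : ℕ} (F : Set (Zd d)) (t : ℝ≥0∞) (n : ℕ) (w : ℕ → Zd d) [DecidablePred (fun k => w k ∈ F)] :
    vis F t n w = t ^ ((Finset.range n).filter (fun k => w k ∈ F)).card := by
  unfold vis
  trans ∏ k ∈ Finset.range n, if (fun k => w k ∈ F) k then t else 1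
  · refine Finset.prod_congr rfl fun k _ => ?_
    by_cases h : w k ∈ F <;> simp [h]
  · rw [← Finset.prod_filter, Finset.prod_const]

open Classical in
noncomputable def rng {d : ℕ} (A : Finset (Zd d)) (w : ℕ → Zd d) : Finset (Zd d) :=
  A.filter (fun z => ∃ n, w n = z)

lemma rng_le {d : ℕ} (F : Set (Zd d)) (t : ℝ≥0∞) (ht : 1 ≤ t) (w : ℕ → Zd d) (A : Finset (Zd d))
    (hA : ∀ z ∈ A, z ∈ F) : t ^ (rng A w).card ≤ ⨆ n, vis F t n w := by
  classical
  have h : ∀ z : Zd d, ∃ n, z ∈ rng A w → w n = z := by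
    intro z
    by_cases hz : z ∈ rng A w
    · obtain ⟨n, hn⟩ := (Finset.mem_filter.1 hz).2
      exact ⟨n, fun _ => hn⟩
    · exact ⟨0, fun h => absurd h hz⟩
  choose f hf using h
  refine le_trans ?_ (le_iSup _ ((rng A w).sup f + 1))
  rw [vis_eq]
  apply pow_le_pow_right₀ ht
  apply Finset.card_le_card_of_injOn f
  · intro z hz
    simp only [Finset.coe_filter, Finset.mem_range, Set.mem_ofPred_eq]
    refine ⟨Nat.lt_succ_of_le (Finset.le_sup (f := f) hz), ?_⟩
    rw [hf z hz]
    exact hA z (Finset.mem_filter.1 hz).1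
  · intro z hz z' hz' h
    rw [← hf z hz, ← hf z' hz', h]

lemma trans_ae {d : ℕ} (F : Set (Zd d)) (t : ℝ≥0∞) (ht : 1 < t) (μ : Measure (ℕ → Zd d)) (c : ℝ≥0∞)
    (hc : c ≠ ⊤)
    (h : ∀ n, ∫⁻ w, vis F t n w ∂μ ≤ c) : ∀ᵐ w ∂μ, ∃ N, ∀ n ≥ N, w n ∉ F := by
  classical
  have h1 : ∀ᵐ w ∂μ, (⨆ n, vis F t n w) < ⊤ := by
    apply ae_lt_top (Measurable.iSup fun n => meas_vis F t n)
    exact ((exp_mom_sup F t ht.le μ c h).trans_lt hc.lt_top).ne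
  filter_upwards [h1] with w hw
  by_contra! hcon
  have h2 : ∀ k, ∃ n, t ^ k ≤ vis F t n w := by
    intro k
    induction k with
    | zero => exact ⟨0, by simp [vis]⟩
    | succ k ih =>
      obtain ⟨n, hn⟩ := ih
      obtain ⟨n', hn', hF⟩ := hcon n
      refine ⟨n'+1, ?_⟩
      have : vis F t (n'+1) w = vis F t n' w * t := by
        unfold vis; rw [Finset.prod_range_succ, if_pos hF]
      rw [this, pow_succ]
      gcongr
      exact hn.trans (vis_mono F t ht.le w hn')
  have h3 : ∀ k, t ^ k ≤ ⨆ n, vis F t n w := fun k => by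
    obtain ⟨n, hn⟩ := h2 k
    exact hn.trans (le_iSup (fun n => vis F t n w) n)
  have h4 := ENNReal.tendsto_pow_atTop_nhds_top_iff.2 ht
  exact absurd (top_le_iff.1 (le_of_tendsto' h4 h3)) hw.ne

lemma avg_symm {d : ℕ} (f g : Zd d → ℝ≥0∞) :
    ∑' x, f x * avg g x = ∑' x, avg f x * g x := by
  unfold avg
  have e1 : ∀ x, f x * ((2 * d : ℝ≥0∞)⁻¹ * ∑ j, g (x + stp d j)) =
      (2 * d : ℝ≥0∞)⁻¹ * ∑ j, f x * g (x + stp d j) := by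
    intro x; rw [← Finset.mul_sum]; ring
  have e2 : ∀ x, ((2 * d : ℝ≥0∞)⁻¹ * ∑ j, f (x + stp d j)) * g x =
      (2 * d : ℝ≥0∞)⁻¹ * ∑ j, f (x + stp d j) * g x := by
    intro x; rw [← Finset.sum_mul]; ring
  simp_rw [e1, e2, ENNReal.tsum_mul_left]
  congr 1
  rw [Summable.tsum_finsetSum (fun _ _ => ENNReal.summable),
    Summable.tsum_finsetSum (fun _ _ => ENNReal.summable)]
  let neg : Fin d × Bool ≃ Fin d × Bool := (Equiv.refl _).prodCongr Equiv.boolNot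
  rw [← neg.sum_comp]
  refine Finset.sum_congr rfl fun j _ => ?_
  rw [← (Equiv.addRight (stp d j)).tsum_eq]
  refine tsum_congr fun x => ?_
  have : x + stp d j + stp d (neg j) = x := by
    have : stp d j + stp d (neg j) = 0 := by
      obtain ⟨i, s⟩ := j
      ext k
      by_cases hk : k = i
      · subst hk; cases s <;> simp [neg, stp]
      · simp [neg, stp, hk]
    rw [add_assoc, this, add_zero]
  simp only [Equiv.coe_addRight, this]

lemma start_congr {d : ℕ} {P : Zd d → Measure (ℕ → Zd d)} (hP : IsSRW d P) (x : Zd d)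
    {E E' : Set (ℕ → Zd d)} (h : ∀ w : ℕ → Zd d, w 0 = x → (w ∈ E ↔ w ∈ E')) : P x E = P x E' := by
  apply measure_congr
  have h0 : ∀ᵐ w ∂(P x), w 0 = x := by
    rw [ae_iff]; exact start_ae hP x
  filter_upwards [h0] with w hw
  exact propext (h w hw)

def Dn {d : ℕ} (K A : Finset (Zd d)) (n : ℕ) : Set (ℕ → Zd d) :=
  {w | (∀ k, 1 ≤ k → k ≤ n → w k ∉ K) ∧ w n ∈ A ∧ ∀ k, n < k → w k ∉ A}

def Rn {d : ℕ} (K : Finset (Zd d)) (n : ℕ) : Set (ℕ → Zd d) :=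
  {w | (∀ k, k < n → w k ∉ K) ∧ w n ∈ K}

lemma meas_in {d : ℕ} (k : ℕ) (K : Finset (Zd d)) : MeasurableSet {w : ℕ → Zd d | w k ∈ K} :=
  meas_mem k (K : Set (Zd d))

lemma meas_nin {d : ℕ} (k : ℕ) (K : Finset (Zd d)) : MeasurableSet {w : ℕ → Zd d | w k ∉ K} :=
  (meas_in k K).compl

lemma meas_Dn {d : ℕ} (K A : Finset (Zd d)) (n : ℕ) : MeasurableSet (Dn K A n) := by
  unfold Dn
  simp only [Set.ofPred_and, Set.ofPred_forall]
  refine MeasurableSet.inter ?_ (MeasurableSet.inter (meas_in _ _) ?_)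
  · exact MeasurableSet.iInter fun k => MeasurableSet.iInter fun _ => MeasurableSet.iInter fun _ => meas_nin _ _
  · exact MeasurableSet.iInter fun k => MeasurableSet.iInter fun _ => meas_nin _ _

lemma meas_Rn {d : ℕ} (K : Finset (Zd d)) (n : ℕ) : MeasurableSet (Rn K n) := by
  unfold Rn
  simp only [Set.ofPred_and, Set.ofPred_forall]
  refine MeasurableSet.inter ?_ (meas_in _ _)
  · exact MeasurableSet.iInter fun k => MeasurableSet.iInter fun _ => meas_nin _ _

lemma Dn_zero {d : ℕ} {P : Zd d → Measure (ℕ → Zd d)} (hP : IsSRW d P) (K A : Finset (Zd d))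
    (x : Zd d) : P x (Dn K A 0) = eqm d P A x := by
  unfold eqm
  split_ifs with h
  · apply start_congr hP
    intro w hw
    simp only [Dn, escSet, Set.mem_ofPred_eq]
    constructor
    · rintro ⟨-, -, h3⟩ n hn
      exact h3 n (by omega)
    · intro h3
      exact ⟨fun k h1 h2 => by omega, by rwa [hw], fun k hk => h3 k (by omega)⟩
  · rw [start_congr hP x (E' := ∅), measure_empty]
    intro w hw
    simp only [Dn, Set.mem_ofPred_eq, Set.mem_empty_iff_false, iff_false]
    rintro ⟨-, h2, -⟩
    rw [hw] at h2; exact h h2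

lemma Dn_succ {d : ℕ} (hd : 0 < d) {P : Zd d → Measure (ℕ → Zd d)} (hP : IsSRW d P) (K A : Finset (Zd d))
    (n : ℕ) (x : Zd d) : P x (Dn K A (n+1)) =
      avg (fun z => (if z ∈ K then 0 else 1) * P z (Dn K A n)) x := by
  rw [one_step_set hd hP x (meas_Dn _ _ _)]
  congr 1
  ext z
  split_ifs with h
  · rw [zero_mul, start_congr hP z (E' := ∅), measure_empty]
    intro w hw
    simp only [Dn, Set.mem_preimage, Set.mem_ofPred_eq, Set.mem_empty_iff_false, iff_false]
    rintro ⟨h1, -⟩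
    have := h1 1 le_rfl (by omega)
    rw [pcons_succ, hw] at this
    exact this h
  · rw [one_mul]
    apply start_congr hP
    intro w hw
    simp only [Dn, Set.mem_preimage, Set.mem_ofPred_eq]
    constructor
    · rintro ⟨h1, h2, h3⟩
      exact ⟨fun k hk hk' => h1 (k+1) (by omega) (by omega), h2, fun k hk => h3 (k+1) (by omega)⟩
    · rintro ⟨h1, h2, h3⟩
      refine ⟨?_, h2, ?_⟩
      · rintro (_ | _ | k) hk hk'
        · omega
        · rw [pcons_succ, hw]; exact h
        · exact h1 (k+1) (by omega) (by omega)
      · rintro (_ | k) hk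
        · omega
        · exact h3 k (by omega)

lemma Rn_zero {d : ℕ} {P : Zd d → Measure (ℕ → Zd d)} (hP : IsSRW d P) (K : Finset (Zd d))
    (x : Zd d) : P x (Rn K 0) = if x ∈ K then 1 else 0 := by
  have := hP.1 x
  split_ifs with h
  · rw [start_congr hP x (E' := Set.univ), measure_univ]
    intro w hw
    simp only [Rn, Set.mem_ofPred_eq, Set.mem_univ, iff_true]
    exact ⟨fun k hk => by omega, by rwa [hw]⟩
  · rw [start_congr hP x (E' := ∅), measure_empty]
    intro w hw
    simp only [Rn, Set.mem_ofPred_eq, Set.mem_empty_iff_false, iff_false]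
    rintro ⟨-, h2⟩
    rw [hw] at h2; exact h h2

lemma Rn_succ {d : ℕ} (hd : 0 < d) {P : Zd d → Measure (ℕ → Zd d)} (hP : IsSRW d P) (K : Finset (Zd d))
    (n : ℕ) (x : Zd d) : P x (Rn K (n+1)) =
      (if x ∈ K then 0 else 1) * avg (fun z => P z (Rn K n)) x := by
  split_ifs with h
  · rw [zero_mul, start_congr hP x (E' := ∅), measure_empty]
    intro w hw
    simp only [Rn, Set.mem_ofPred_eq, Set.mem_empty_iff_false, iff_false]
    rintro ⟨h1, -⟩
    have := h1 0 (by omega)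
    rw [hw] at this
    exact this h
  · rw [one_mul, one_step_set hd hP x (meas_Rn _ _)]
    congr 1
    ext z
    congr 1
    ext w
    simp only [Rn, Set.mem_preimage, Set.mem_ofPred_eq]
    constructor
    · rintro ⟨h1, h2⟩
      exact ⟨fun k hk => h1 (k+1) (by omega), h2⟩
    · rintro ⟨h1, h2⟩
      refine ⟨?_, h2⟩
      rintro (_ | k) hk
      · exact h
      · exact h1 k (by omega)

lemma dual {d : ℕ} (hd : 0 < d) {P : Zd d → Measure (ℕ → Zd d)} (hP : IsSRW d P) (K A : Finset (Zd d))
    (n m : ℕ) : ∑' x, P x (Rn K m) * P x (Dn K A n) = ∑' x, P x (Rn K (m+n)) * P x (Dn K A 0) := by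
  induction n generalizing m with
  | zero => rfl
  | succ n ih =>
    simp_rw [Dn_succ hd hP]
    rw [avg_symm]
    have := ih (m+1)
    rw [show m + (n+1) = m+1+n by ring, ← this]
    refine tsum_congr fun x => ?_
    rw [Rn_succ hd hP]
    ring

lemma sum_Rn {d : ℕ} (P : Zd d → Measure (ℕ → Zd d)) (K : Finset (Zd d))
    (x : Zd d) : ∑' n, P x (Rn K n) = P x {w | ∃ n, w n ∈ K} := by
  classical
  rw [← measure_iUnion _ (fun n => meas_Rn K n)]
  · congr 1
    ext w
    simp only [Set.mem_iUnion, Rn, Set.mem_ofPred_eq]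
    constructor
    · rintro ⟨n, -, h⟩; exact ⟨n, h⟩
    · intro h
      exact ⟨Nat.find h, fun k hk => Nat.find_min h hk, Nat.find_spec h⟩
  · intro i j hij
    rw [Function.onFun, Set.disjoint_left]
    rintro w ⟨h1, h2⟩ ⟨h3, h4⟩
    rcases lt_or_gt_of_ne hij with h | h
    · exact h3 i h h2
    · exact h1 j h h4

lemma sum_Dn {d : ℕ} {P : Zd d → Measure (ℕ → Zd d)} (hP : IsSRW d P) (K A : Finset (Zd d))
    (hKA : K ⊆ A) (htr : ∀ x ∈ A, ∀ᵐ w ∂(P x), ∃ N, ∀ n ≥ N, w n ∉ A)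
    (x : Zd d) (hx : x ∈ K) : ∑' n, P x (Dn K A n) = P x (escSet d K) := by
  classical
  rw [← measure_iUnion _ (fun n => meas_Dn K A n)]
  · apply measure_congr
    have h0 : ∀ᵐ w ∂(P x), w 0 = x := by
      rw [ae_iff]; exact start_ae hP x
    filter_upwards [h0, htr x (hKA hx)] with w hw htw
    apply propext
    change w ∈ (⋃ n, Dn K A n) ↔ w ∈ escSet d K
    simp only [Set.mem_iUnion, Dn, escSet, Set.mem_ofPred_eq]
    constructor
    · rintro ⟨n, h1, h2, h3⟩ k hk
      rcases le_or_gt k n with h | h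
      · exact h1 k hk h
      · exact fun h' => h3 k h (hKA h')
    · intro h
      have hN := Nat.find_spec htw
      have hmin := fun k => Nat.find_min htw (m := k)
      set N := Nat.find htw
      have hN0 : N ≠ 0 := by
        intro h0
        refine hN 0 (by omega) ?_
        rw [hw]; exact hKA hx
      obtain ⟨M, hM⟩ := Nat.exists_eq_succ_of_ne_zero hN0
      refine ⟨M, fun k hk _ => h k hk, ?_, fun k hk => hN k (by omega)⟩
      have := hmin M (by omega)
      by_contra hc
      apply this
      intro n hn
      rcases Nat.eq_or_lt_of_le hn with h' | h'
      · rw [← h']; exact hc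
      · exact hN n (by omega)
  · intro i j hij
    rw [Function.onFun, Set.disjoint_left]
    rintro w ⟨-, h1, h2⟩ ⟨-, h3, h4⟩
    rcases lt_or_gt_of_ne hij with h | h
    · exact h2 j h h3
    · exact h4 i h h1

lemma sweep {d : ℕ} (hd : 0 < d) {P : Zd d → Measure (ℕ → Zd d)} (hP : IsSRW d P) (K A : Finset (Zd d))
    (hKA : K ⊆ A) (htr : ∀ x ∈ A, ∀ᵐ w ∂(P x), ∃ N, ∀ n ≥ N, w n ∉ A) :
    capa d P K = ∑ x ∈ A, eqm d P A x * P x {w | ∃ n, w n ∈ K} := by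
  have h1 : capa d P K = ∑' x, ∑' n, P x (Rn K 0) * P x (Dn K A n) := by
    simp_rw [ENNReal.tsum_mul_left, Rn_zero hP]
    rw [tsum_eq_sum (s := K)]
    · unfold capa
      refine Finset.sum_congr rfl fun x hx => ?_
      rw [sum_Dn hP K A hKA htr x hx, if_pos hx, one_mul, eqm, if_pos hx]
    · intro x hx; rw [if_neg hx, zero_mul]
  rw [h1, ENNReal.tsum_comm]
  simp_rw [dual hd hP K A _ 0, zero_add]
  rw [ENNReal.tsum_comm]
  simp_rw [ENNReal.tsum_mul_right, sum_Rn, Dn_zero hP]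
  rw [tsum_eq_sum (s := A)]
  · refine Finset.sum_congr rfl fun x _ => mul_comm _ _
  · intro x hx; rw [eqm, if_neg hx, mul_zero]

lemma meas_rng {d : ℕ} (A S : Finset (Zd d)) : MeasurableSet {w | rng A w = S} := by
  classical
  by_cases hS : S ⊆ A
  · have : {w | rng A w = S} = ⋂ z ∈ A, {w : ℕ → Zd d | (∃ n, w n = z) ↔ z ∈ S} := by
      ext w
      simp only [Set.mem_ofPred_eq, Set.mem_iInter, rng]
      constructor
      · rintro h z hz
        rw [← h, Finset.mem_filter]
        tauto
      · intro h
        ext z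
        rw [Finset.mem_filter]
        constructor
        · rintro ⟨h1, h2⟩; exact (h z h1).1 h2
        · intro h1; exact ⟨hS h1, (h z (hS h1)).2 h1⟩
    rw [this]
    refine Finset.measurableSet_biInter _ fun z _ => ?_
    have hm : MeasurableSet {w : ℕ → Zd d | ∃ n, w n = z} := by
      rw [Set.ofPred_exists]
      exact MeasurableSet.iUnion fun n => meas_eq n z
    by_cases hz : z ∈ S
    · simpa [hz] using hm
    · have : {w : ℕ → Zd d | (∃ n, w n = z) ↔ z ∈ S} = {w : ℕ → Zd d | ∃ n, w n = z}ᶜ := by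
        ext w; simp [hz]
      rw [this]; exact hm.compl
  · have : {w | rng A w = S} = ∅ := by
      ext w
      simp only [Set.mem_ofPred_eq, Set.mem_empty_iff_false, iff_false]
      rintro rfl
      exact hS (Finset.filter_subset _ _)
    rw [this]; exact MeasurableSet.empty

lemma lint_rng {d : ℕ} (A : Finset (Zd d)) (φ : Finset (Zd d) → ℝ≥0∞) (μ : Measure (ℕ → Zd d)) :
    ∫⁻ w, φ (rng A w) ∂μ = ∑ S ∈ A.powerset, φ S * μ {w | rng A w = S} := by
  classical
  have : ∀ w, φ (rng A w) = ∑ S ∈ A.powerset, φ S * ({w | rng A w = S} : Set (ℕ → Zd d)).indicator 1 w := by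
    intro w
    rw [Finset.sum_eq_single (rng A w)]
    · simp
    · intro S _ hS
      simp [Ne.symm hS]
    · intro h
      exact absurd (Finset.mem_powerset.2 (Finset.filter_subset _ _)) h
  simp_rw [this]
  rw [lintegral_finsetSum]
  · refine Finset.sum_congr rfl fun S _ => ?_
    rw [lintegral_const_mul, lintegral_indicator_one (meas_rng A S)]
    exact measurable_one.indicator (meas_rng A S)
  · intro S _
    exact (measurable_one.indicator (meas_rng A S)).const_mul _

noncomputable def mu {d : ℕ} (P : Zd d → Measure (ℕ → Zd d)) (A S : Finset (Zd d)) : ℝ≥0∞ :=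
  ∑ x ∈ A, eqm d P A x * P x {w | rng A w = S}

lemma eqm_le {d : ℕ} {P : Zd d → Measure (ℕ → Zd d)} (hP : IsSRW d P) (A : Finset (Zd d)) (x) :
    eqm d P A x ≤ 1 := by
  have := hP.1 x
  unfold eqm
  split_ifs
  · exact prob_le_one
  · exact zero_le

lemma mu_top {d : ℕ} {P : Zd d → Measure (ℕ → Zd d)} (hP : IsSRW d P) (A S : Finset (Zd d)) :
    mu P A S ≠ ⊤ := by
  unfold mu
  refine ENNReal.sum_ne_top.2 fun x _ => ?_
  have := hP.1 x
  exact ENNReal.mul_ne_top ((eqm_le hP A x).trans_lt ENNReal.one_lt_top).ne (measure_ne_top _ _)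

lemma sum_mu {d : ℕ} (P : Zd d → Measure (ℕ → Zd d)) (A : Finset (Zd d)) (φ : Finset (Zd d) → ℝ≥0∞) :
    ∑ S ∈ A.powerset, mu P A S * φ S = ∑ x ∈ A, eqm d P A x * ∫⁻ w, φ (rng A w) ∂(P x) := by
  unfold mu
  simp_rw [lint_rng, Finset.mul_sum, Finset.sum_mul]
  rw [Finset.sum_comm]
  refine Finset.sum_congr rfl fun x _ => Finset.sum_congr rfl fun S _ => ?_
  ring

open Classical in
lemma capa_mu {d : ℕ} (hd : 0 < d) {P : Zd d → Measure (ℕ → Zd d)} (hP : IsSRW d P) (K A : Finset (Zd d))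
    (hKA : K ⊆ A) (htr : ∀ x ∈ A, ∀ᵐ w ∂(P x), ∃ N, ∀ n ≥ N, w n ∉ A) :
    (capa d P K).toReal = ∑ S ∈ A.powerset, (mu P A S).toReal * (if Disjoint S K then 0 else 1) := by
  have h : capa d P K = ∑ S ∈ A.powerset, mu P A S * (if Disjoint S K then 0 else 1) := by
    rw [sweep hd hP K A hKA htr, sum_mu]
    refine Finset.sum_congr rfl fun x _ => ?_
    congr 1
    have hm : MeasurableSet {w : ℕ → Zd d | ∃ n, w n ∈ K} := by
      rw [Set.ofPred_exists]
      exact MeasurableSet.iUnion fun n => meas_in n K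
    rw [← lintegral_indicator_one hm]
    congr 1
    ext w
    have : Disjoint (rng A w) K ↔ ¬ ∃ n, w n ∈ K := by
      rw [Finset.disjoint_left]
      constructor
      · rintro h ⟨n, hn⟩
        exact h (Finset.mem_filter.2 ⟨hKA hn, n, rfl⟩) hn
      · rintro h z hz hK
        obtain ⟨n, rfl⟩ := (Finset.mem_filter.1 hz).2
        exact h ⟨n, hK⟩
    by_cases h : ∃ n, w n ∈ K
    · rw [if_neg (by rw [this]; exact not_not.2 h), Set.indicator_of_mem (show w ∈ {w : ℕ → Zd d | ∃ n, w n ∈ K} from h)]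
      rfl
    · rw [if_pos (this.2 h), Set.indicator_of_notMem (show w ∉ {w : ℕ → Zd d | ∃ n, w n ∈ K} from h)]
  rw [h, ENNReal.toReal_sum]
  · refine Finset.sum_congr rfl fun S _ => ?_
    rw [ENNReal.toReal_mul]
    split_ifs <;> simp
  · intro S _
    refine ENNReal.mul_ne_top (mu_top hP A S) ?_
    split_ifs <;> simp

lemma vacant_bound {d : ℕ} (hd : 0 < d) {P : Zd d → Measure (ℕ → Zd d)} (hP : IsSRW d P)
    (A : Finset (Zd d)) (htr : ∀ x ∈ A, ∀ᵐ w ∂(P x), ∃ N, ∀ n ≥ N, w n ∉ A)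
    (t c u : ℝ) (ht : 1 ≤ t) (hc : 0 ≤ c) (hu : 0 ≤ u)
    (hb : ∀ x ∈ A, ∫⁻ w, (ENNReal.ofReal t) ^ (rng A w).card ∂(P x) ≤ ENNReal.ofReal c)
    (Q : Measure (Zd d → Bool)) (hQ : IsVacantLaw d P u Q) :
    Q.real {ω | ∀ z ∈ A, ω z = false} ≤ (t ^ A.card)⁻¹ * Real.exp (u * (c * A.card)) := by
  classical
  have := hQ.1
  have ht0 : 0 ≤ t := by linarith
  rw [incl_excl]
  have e1 : ∑ K ∈ A.powerset, (-1 : ℝ) ^ K.card * Q.real {ω | ∀ z ∈ K, ω z = true} =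
      ∑ K ∈ A.powerset, (-1 : ℝ) ^ K.card *
      Real.exp (-(∑ S ∈ A.powerset, (u * (mu P A S).toReal) * (if Disjoint S K then 0 else 1))) := by
    refine Finset.sum_congr rfl fun K hK => ?_
    rw [measureReal_def, hQ.2 K, ENNReal.toReal_ofReal (Real.exp_pos _).le,
      capa_mu hd hP K A (Finset.mem_powerset.1 hK) htr, Finset.mul_sum]
    simp only [mul_assoc]
  rw [e1]
  refine (moebius_bound A (fun S => u * (mu P A S).toReal)
    (fun S => mul_nonneg hu ENNReal.toReal_nonneg) t ht).trans ?_
  apply mul_le_mul_of_nonneg_left _ (by positivity)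
  apply Real.exp_le_exp.2
  simp only [mul_assoc]
  rw [← Finset.mul_sum]
  apply mul_le_mul_of_nonneg_left _ hu
  have h2 : ∑ S ∈ A.powerset, mu P A S * (ENNReal.ofReal t) ^ S.card ≤ ENNReal.ofReal (c * A.card) := by
    rw [sum_mu P A (fun S => (ENNReal.ofReal t) ^ S.card)]
    calc _ ≤ ∑ x ∈ A, 1 * ENNReal.ofReal c :=
          Finset.sum_le_sum fun x hx => mul_le_mul' (eqm_le hP A x) (hb x hx)
      _ = _ := by
          rw [ENNReal.ofReal_mul hc]; simp [mul_comm]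
  have h3 := ENNReal.toReal_mono ENNReal.ofReal_ne_top h2
  rw [ENNReal.toReal_ofReal (by positivity), ENNReal.toReal_sum] at h3
  · refine le_trans (le_of_eq (Finset.sum_congr rfl fun S _ => ?_)) h3
    rw [ENNReal.toReal_mul, ENNReal.toReal_pow, ENNReal.toReal_ofReal ht0]
  · intro S _
    exact ENNReal.mul_ne_top (mu_top hP A S) (ENNReal.pow_ne_top ENNReal.ofReal_ne_top)

/-- **Theorem 2.4, (2.23).** For `d ≥ 4`, `1 ≤ m ≤ d − 3` and `λ > 0` with `χ(λ) < 1`,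
there is `u₁ = u₁(d,m,λ) > 0` such that for all `0 ≤ u ≤ u₁` and every finite subset `A`
of an `m`-dimensional coordinate affine sublattice of `ℤ^d`,
`P[𝓘^u ⊇ A] ≤ exp(−λ|A|)`, i.e. `Q[Y ≡ 0 on A] ≤ exp(−λ|A|)` for every vacant-set law
`Q` at level `u`. -/
theorem exp_bound_contains_low_dim_set
    (d m : ℕ) (hd : 4 ≤ d) (hm1 : 1 ≤ m) (hm2 : m ≤ d - 3)
    (P : Zd d → Measure (ℕ → Zd d)) (hP : IsSRW d P)
    (Pm : Zd (d - m) → Measure (ℕ → Zd (d - m))) (hPm : IsSRW (d - m) Pm)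
    (lam : ℝ) (hlam : 0 < lam)
    (hchi : chiVal d m (retProb (d - m) Pm) lam < 1) :
    ∃ u₁ : ℝ, 0 < u₁ ∧
      ∀ u : ℝ, 0 ≤ u → u ≤ u₁ →
      ∀ (I : Finset (Fin d)), I.card = m →
      ∀ (y : Zd d) (A : Finset (Zd d)), (∀ z ∈ A, ∀ i : Fin d, i ∉ I → z i = y i) →
      ∀ Q : Measure (Zd d → Bool), IsVacantLaw d P u Q →
        Q {ω | ∀ z ∈ A, ω z = false}
          ≤ ENNReal.ofReal (Real.exp (-(lam * A.card))) := by
  have hd0 : 0 < d := by omega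
  have hν : 0 < d - m := by omega
  set q := retProb (d - m) Pm with hq
  set p : ℝ := (m : ℝ) / d + (1 - (m : ℝ) / d) * q with hpdef
  have hchi' : ∀ᶠ l in nhds lam, Real.exp l * p < 1 := by
    have hcont : ContinuousAt (fun l => Real.exp l * p) lam := by fun_prop
    exact hcont.eventually_lt continuousAt_const hchi
  obtain ⟨l, hl, hlp⟩ := hchi'.exists_gt
  set t := Real.exp l with ht
  have hl0 : 0 < l := hlam.trans hl
  have ht1 : 1 < t := Real.one_lt_exp_iff.2 hl0
  have hq0 : 0 ≤ q := ENNReal.toReal_nonneg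
  have hdR : (0 : ℝ) < d := by exact_mod_cast hd0
  have hmd : (m : ℝ) / d ≤ 1 := by
    rw [div_le_one hdR]; exact_mod_cast (by omega : m ≤ d)
  have hp0 : 0 ≤ p := by
    have : 0 ≤ 1 - (m : ℝ) / d := by linarith
    positivity
  set b : ℝ := (t - 1) / (1 - t * p) with hb
  have hden : 0 < 1 - t * p := by linarith
  have hb0 : 0 ≤ b := div_nonneg (by linarith) hden.le
  have htb : t * (1 + b * p) = 1 + b := by
    rw [hb]; field_simp; ring
  have htb' : ENNReal.ofReal t * (1 + ENNReal.ofReal b * ENNReal.ofReal p) = 1 + ENNReal.ofReal b := by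
    rw [← ENNReal.ofReal_mul hb0, ← ENNReal.ofReal_one, ← ENNReal.ofReal_add zero_le_one (by positivity),
      ← ENNReal.ofReal_mul (by positivity), htb, ENNReal.ofReal_add zero_le_one hb0]
  have hav : avg (hit (d - m) Pm) 0 = ENNReal.ofReal q := by
    have := hPm.1 0
    rw [hq, retProb, ENNReal.ofReal_toReal (measure_ne_top _ _), hit_ret hν hPm]
  have hpE : ENNReal.ofReal p = (2 * d : ℝ≥0∞)⁻¹ *
      (2 * m + 2 * (d - m : ℕ) * avg (hit (d - m) Pm) 0) := by
    rw [hav]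
    have e2 : ((2 * d : ℝ≥0∞)⁻¹ * (2 * m + 2 * (d - m : ℕ) * ENNReal.ofReal q)).toReal = p := by
      rw [ENNReal.toReal_mul, ENNReal.toReal_inv, ENNReal.toReal_add]
      · simp only [ENNReal.toReal_mul, ENNReal.toReal_ofNat, ENNReal.toReal_natCast,
          ENNReal.toReal_ofReal hq0]
        rw [Nat.cast_sub (by omega), hpdef]
        field_simp
      · exact ENNReal.mul_ne_top (by simp) (by simp)
      · exact ENNReal.mul_ne_top (ENNReal.mul_ne_top (by simp) (by simp)) ENNReal.ofReal_ne_top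
    rw [← e2, ENNReal.ofReal_toReal]
    refine ENNReal.mul_ne_top (ENNReal.inv_ne_top.2 (two_d_ne hd0)) (ENNReal.add_ne_top.2 ⟨?_, ?_⟩)
    · exact ENNReal.mul_ne_top (by simp) (by simp)
    · exact ENNReal.mul_ne_top (ENNReal.mul_ne_top (by simp) (by simp)) ENNReal.ofReal_ne_top
  have hc0 : 0 < 1 + b := by linarith
  refine ⟨(l - lam) / (1 + b), div_pos (by linarith) hc0, ?_⟩
  intro u hu0 hu1 I hI y A hA Q hQ
  have hcard : Fintype.card {i // i ∉ I} = d - m := by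
    rw [Fintype.card_subtype_compl, Fintype.card_fin, Fintype.card_coe, hI]
  let e : Fin (d - m) ≃ {i // i ∉ I} := (Fintype.equivFinOfCardEq hcard).symm
  set F : Set (Zd d) := {z | ∀ i, i ∉ I → z i = y i} with hF
  have hAF : ∀ z ∈ A, z ∈ F := fun z hz => hA z hz
  have hmom : ∀ x ∈ A, ∀ n, ∫⁻ w, vis F (ENNReal.ofReal t) n w ∂(P x) ≤ ENNReal.ofReal (1 + b) := by
    intro x hx n
    have := exp_mom hd0 hν (by omega) e y hP hPm (ENNReal.ofReal t) (ENNReal.ofReal b)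
      (ENNReal.ofReal p) htb' (by rw [hI]; exact hpE) n x
    rw [(prj_zero e y x).2 (hA x hx), hit_zero hPm, mul_one] at this
    rw [ENNReal.ofReal_add zero_le_one hb0, ENNReal.ofReal_one]
    exact this
  have ht1E : 1 < ENNReal.ofReal t := by
    rw [← ENNReal.ofReal_one]; exact (ENNReal.ofReal_lt_ofReal_iff (by linarith)).2 ht1
  have hb' : ∀ x ∈ A, ∫⁻ w, (ENNReal.ofReal t) ^ (rng A w).card ∂(P x) ≤ ENNReal.ofReal (1 + b) := by
    intro x hx
    refine (lintegral_mono fun w => rng_le F _ ht1E.le w A hAF).trans ?_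
    exact exp_mom_sup F _ ht1E.le _ _ (hmom x hx)
  have htr : ∀ x ∈ A, ∀ᵐ w ∂(P x), ∃ N, ∀ n ≥ N, w n ∉ A := by
    intro x hx
    filter_upwards [trans_ae F _ ht1E (P x) _ ENNReal.ofReal_ne_top (hmom x hx)] with w ⟨N, hN⟩
    exact ⟨N, fun n hn h => hN n hn (hAF _ h)⟩
  have key := vacant_bound hd0 hP A htr t (1 + b) u ht1.le hc0.le hu0 hb' Q hQ
  have := hQ.1
  rw [← ENNReal.ofReal_toReal (measure_ne_top Q {ω | ∀ z ∈ A, ω z = false})]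
  apply ENNReal.ofReal_le_ofReal
  refine key.trans ?_
  rw [ht, ← Real.exp_nat_mul, ← Real.exp_neg, ← Real.exp_add]
  apply Real.exp_le_exp.2
  rw [le_div_iff₀ hc0] at hu1
  have : (0 : ℝ) ≤ A.card := Nat.cast_nonneg _
  nlinarith
end

section
/- (Absence of percolation for large u.) Let d ≥ 3. There exists u∞ < ∞ such that for every u ≥ u∞ and every vacant-set law Q at level u on {0,1}^{ℤ^d}: Q[the set {x ∈ ℤ^d : Y_x = 1} has an infinite nearest-neighbor connected component] = 0. In particular, if for every u ≥ 0 a vacant-set law at level u exists, then the critical value u_* = inf{u ≥ 0 : η(u) = 0} is finite, where η(u) is the probability under the level-u vacant-set law that 0 belongs to an infinite nearest-neighbor connected component of {x : Y_x = 1}. -/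
open MeasureTheory
open scoped ENNReal

/-- `x` and `y` are connected by a nearest-neighbor path inside `S`. -/
def connectedIn {d : ℕ} (S : Set (Zd d)) (x y : Zd d) : Prop :=
  ∃ (n : ℕ) (γ : ℕ → Zd d), γ 0 = x ∧ γ n = y ∧ (∀ k ≤ n, γ k ∈ S) ∧
    ∀ k < n, adj (γ (k + 1)) (γ k)


namespace RI

/-- squared Euclidean norm -/
noncomputable def sq {d : ℕ} (z : Zd d) : ℝ := ∑ i, (z i : ℝ) ^ 2

noncomputable def FF {d : ℕ} (z : Zd d) : ℝ := 4 * (sq z + 256) ^ (-(1/4) : ℝ)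

lemma sq_nonneg' {d : ℕ} (z : Zd d) : 0 ≤ sq z := Finset.sum_nonneg fun _ _ => by positivity

lemma FF_nonneg {d : ℕ} (z : Zd d) : 0 ≤ FF z := by
  have := sq_nonneg' z
  unfold FF; positivity

lemma rpow_four (x : ℝ) (hx : 0 ≤ x) : (x ^ (-(1/4) : ℝ)) = (x ^ (1/4 : ℝ))⁻¹ :=
  Real.rpow_neg hx _

lemma FF_zero {d : ℕ} : FF (0 : Zd d) = 1 := by
  have : sq (0 : Zd d) = 0 := by simp [sq]
  unfold FF
  rw [this, rpow_four _ (by norm_num)]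
  have : (0 + 256 : ℝ) = 4 ^ (4 : ℝ) := by norm_num
  rw [this, ← Real.rpow_mul (by norm_num)]
  norm_num

lemma rp_bound (a : ℝ) (h1 : -(1/10) ≤ a) (h2 : a ≤ 1/10) :
    (1 + a) ^ (-(1/4) : ℝ) ≤ 1 - a / 4 + 3 * a ^ 2 / 16 := by
  have hq : 0 < 1 - a / 4 + 3 * a ^ 2 / 16 := by nlinarith [sq_nonneg a]
  have ha : 0 < 1 + a := by linarith
  rw [rpow_four _ ha.le]
  apply inv_le_of_inv_le₀ hq
  set q := 1 - a / 4 + 3 * a ^ 2 / 16 with hqd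
  have key : 1 ≤ (1 + a) * q ^ 4 := by
    have hqe : (1 + a) * q ^ 4 = 1 + a ^ 2 * ((1/8)*a^0+(1/2)*a^1+(-69/256)*a^2+(61/256)*a^3+(-159/2048)*a^4+(135/4096)*a^5+(-351/65536)*a^6+(81/65536)*a^7) := by
      rw [hqd]; ring
    have hab : |a| ≤ 1/10 := abs_le.2 ⟨by linarith, h2⟩
    have hp : ∀ n : ℕ, |a ^ n| ≤ (1/10) ^ n := fun n => by
      rw [abs_pow]; exact pow_le_pow_left₀ (abs_nonneg _) hab n
    have hr : 0 ≤ (1/8)*a^0+(1/2)*a^1+(-69/256)*a^2+(61/256)*a^3+(-159/2048)*a^4+(135/4096)*a^5+(-351/65536)*a^6+(81/65536)*a^7 := by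
      have := fun n => abs_le.1 (hp n)
      have e1 := this 1
      have e2 := this 2
      have e3 := this 3
      have e4 := this 4
      have e5 := this 5
      have e6 := this 6
      have e7 := this 7
      norm_num at e1 e2 e3 e4 e5 e6 e7 ⊢
      linarith
    rw [hqe]
    have := mul_nonneg (sq_nonneg a) hr
    linarith
  have h4 : (q⁻¹) ^ 4 ≤ 1 + a := by
    rw [inv_pow, inv_le_iff_one_le_mul₀ (by positivity)]
    linarith
  have : q⁻¹ = ((q⁻¹) ^ 4) ^ (1/4 : ℝ) := by
    rw [← Real.rpow_natCast, ← Real.rpow_mul (by positivity)]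
    norm_num
  rw [this]
  exact Real.rpow_le_rpow (by positivity) h4 (by norm_num)

lemma sq_add {d : ℕ} (z : Zd d) (i : Fin d) (c : ℤ) (hc : c ^ 2 = 1) :
    sq (z + Pi.single i c) = sq z + (1 + 2 * c * z i) := by
  have hc' : (c : ℝ) ^ 2 = 1 := by exact_mod_cast hc
  have : ∀ j, ((((z + Pi.single i c : Zd d)) j : ℤ) : ℝ) ^ 2 = (z j : ℝ) ^ 2 +
      if j = i then (1 + 2 * c * z i : ℝ) else 0 := by
    intro j
    by_cases h : j = i
    · subst h; simp; linear_combination hc'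
    · simp [h]
  unfold sq
  simp_rw [this]
  rw [Finset.sum_add_distrib]
  simp

lemma coord_le {d : ℕ} (z : Zd d) (i : Fin d) : (z i : ℝ) ^ 2 ≤ sq z :=
  Finset.single_le_sum (f := fun i => (z i : ℝ) ^ 2) (fun _ _ => by positivity) (Finset.mem_univ i)

lemma FF_step {d : ℕ} (z : Zd d) (i : Fin d) (c : ℤ) (hc : c ^ 2 = 1) :
    FF (z + Pi.single i c) ≤ FF z * (1 - ((1 + 2 * c * z i) / (sq z + 256)) / 4
      + 3 * ((1 + 2 * c * z i) / (sq z + 256)) ^ 2 / 16) := by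
  have hc' : (c : ℝ) ^ 2 = 1 := by exact_mod_cast hc
  have h0 := sq_nonneg' z
  have h1 := coord_le z i
  have hs : 0 < sq z + 256 := by linarith
  have hcz : ((c : ℝ) * z i) ^ 2 ≤ sq z := by rw [mul_pow, hc']; linarith
  set t := (c : ℝ) * z i with ht
  have e : (1 + 2 * (c:ℝ) * z i) = 1 + 2 * t := by rw [ht]; ring
  have hadd := sq_add z i c hc
  rw [e] at hadd ⊢
  have b0 : -(1/10) ≤ (1 + 2 * t) / (sq z + 256) := by
    rw [le_div_iff₀ hs]; nlinarith [sq_nonneg (t + 10)]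
  have b := rp_bound ((1 + 2 * t) / (sq z + 256)) b0
    (by rw [div_le_iff₀ hs]; nlinarith [sq_nonneg (t - 10)])
  unfold FF
  rw [hadd]
  have : sq z + (1 + 2 * t) + 256 = (sq z + 256) * (1 + (1 + 2 * t) / (sq z + 256)) := by
    field_simp; ring
  rw [this, Real.mul_rpow hs.le (by linarith [b0])]
  have hp : 0 ≤ 4 * (sq z + 256) ^ (-(1/4) : ℝ) := by positivity
  rw [← mul_assoc]
  exact mul_le_mul_of_nonneg_left b hp

lemma FF_super {d : ℕ} (hd : 3 ≤ d) (z : Zd d) :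
    ∑ i : Fin d, (FF (z + Pi.single i 1) + FF (z + Pi.single i (-1))) ≤ 2 * d * FF z := by
  have h0 := sq_nonneg' z
  have hs : 0 < sq z + 256 := by linarith
  have hF := FF_nonneg z
  have hd' : (3 : ℝ) ≤ d := by exact_mod_cast hd
  calc _ ≤ ∑ i : Fin d, FF z * (2 - 1 / (2 * (sq z + 256))
      + 3 / 16 * (2 + 8 * (z i : ℝ) ^ 2) / (sq z + 256) ^ 2) := by
        apply Finset.sum_le_sum
        intro i _
        have a1 := FF_step z i 1 (by norm_num)
        have a2 := FF_step z i (-1) (by norm_num)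
        refine (add_le_add a1 a2).trans (le_of_eq ?_)
        rw [← mul_add]
        congr 1
        push_cast
        field_simp
        ring
    _ = FF z * (2 * d + (-(d / 2) * (sq z + 256) + 3 / 16 * (2 * d + 8 * sq z)) / (sq z + 256) ^ 2) := by
        rw [← Finset.mul_sum, Finset.sum_add_distrib, ← Finset.sum_div, ← Finset.mul_sum,
          Finset.sum_add_distrib, ← Finset.mul_sum]
        simp only [Finset.sum_const, Finset.card_univ, Fintype.card_fin, nsmul_eq_mul]
        change FF z * (_ + 3 / 16 * (_ + 8 * sq z) / _) = _
        congr 1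
        field_simp
        ring
    _ ≤ FF z * (2 * d) := by
        apply mul_le_mul_of_nonneg_left _ hF
        have : (-((d:ℝ) / 2) * (sq z + 256) + 3 / 16 * (2 * d + 8 * sq z)) / (sq z + 256) ^ 2 ≤ 0 := by
          apply div_nonpos_of_nonpos_of_nonneg _ (by positivity)
          nlinarith
        linarith
    _ = _ := by ring

lemma norm_sq_le {d : ℕ} (z : Zd d) : ‖z‖ ^ 2 ≤ sq z := by
  have : ‖z‖ ≤ Real.sqrt (sq z) := by
    rw [pi_norm_le_iff_of_nonneg (Real.sqrt_nonneg _)]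
    intro i
    apply Real.le_sqrt_of_sq_le
    rw [Int.norm_eq_abs, sq_abs]
    exact coord_le z i
  calc _ ≤ (Real.sqrt (sq z)) ^ 2 := by gcongr
    _ = _ := Real.sq_sqrt (sq_nonneg' z)

lemma FF_far {d : ℕ} (z : Zd d) (k : ℕ) (h : (1024 : ℝ) ^ k ≤ ‖z‖) : FF z ≤ 4 / 32 ^ k := by
  have h0 := sq_nonneg' z
  have h1 : ((32 : ℝ) ^ k) ^ 4 ≤ sq z + 256 := by
    calc ((32 : ℝ) ^ k) ^ 4 = (1024 ^ k) ^ 2 := by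
          rw [← pow_mul, ← pow_mul, mul_comm k, mul_comm k, pow_mul, pow_mul]; norm_num
      _ ≤ ‖z‖ ^ 2 := by gcongr
      _ ≤ _ := by linarith [norm_sq_le z]
  unfold FF
  rw [rpow_four _ (by linarith), div_eq_mul_inv]
  apply mul_le_mul_of_nonneg_left _ (by norm_num)
  apply inv_anti₀ (by positivity)
  calc (32 : ℝ) ^ k = (((32 : ℝ) ^ k) ^ 4) ^ (1/4 : ℝ) := by
        rw [← Real.rpow_natCast _ 4, ← Real.rpow_mul (by positivity)]
        norm_num
    _ ≤ _ := Real.rpow_le_rpow (by positivity) h1 (by norm_num)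

end RI

namespace RI

lemma adj_cases {d : ℕ} {z v : Zd d} (h : adj z v) :
    ∃ i, z = v + Pi.single i 1 ∨ z = v + Pi.single i (-1) := by
  unfold adj at h
  obtain ⟨i, hi⟩ : ∃ i, (z i - v i).natAbs ≠ 0 := by
    by_contra! hc
    rw [Finset.sum_eq_zero (fun i _ => hc i)] at h
    omega
  have hs := Finset.add_sum_erase Finset.univ (fun i => (z i - v i).natAbs) (Finset.mem_univ i)
  rw [h] at hs
  have h1 : (z i - v i).natAbs = 1 := by omega
  have h2 : ∑ j ∈ Finset.univ.erase i, (z j - v j).natAbs = 0 := by omega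
  rw [Finset.sum_eq_zero_iff] at h2
  have h3 : ∀ j, j ≠ i → z j = v j := fun j hj => by
    have := h2 j (by simp [hj]); omega
  refine ⟨i, ?_⟩
  have h4 : z i = v i + 1 ∨ z i = v i + -1 := by omega
  rcases h4 with h4 | h4
  · left; ext j
    by_cases hj : j = i
    · subst hj; simp [h4]
    · simp [hj, h3 j hj]
  · right; ext j
    by_cases hj : j = i
    · subst hj; simp [h4]
    · simp [hj, h3 j hj]

lemma adj_single {d : ℕ} (v : Zd d) (i : Fin d) : adj (v + Pi.single i 1) v := by
  unfold adj
  rw [Finset.sum_eq_single i]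
  · simp
  · intro j _ hj; simp [hj]
  · simp

lemma adj_symm {d : ℕ} {z v : Zd d} (h : adj z v) : adj v z := by
  unfold adj at *
  rw [← h]
  apply Finset.sum_congr rfl
  intro i _
  omega

lemma adj_norm {d : ℕ} {z v : Zd d} (h : adj z v) : ‖z - v‖ ≤ 1 := by
  rw [pi_norm_le_iff_of_nonneg zero_le_one]
  intro i
  unfold adj at h
  have := Finset.single_le_sum (f := fun i => (z i - v i).natAbs) (fun _ _ => by positivity)
    (Finset.mem_univ i)
  rw [h] at this
  rw [Int.norm_eq_abs]
  have : |z i - v i| ≤ 1 := abs_le.2 ⟨by omega, by omega⟩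
  simp only [Pi.sub_apply]
  exact_mod_cast this

def cyl {d : ℕ} (γ : ℕ → Zd d) (m : ℕ) : Set (ℕ → Zd d) := {w | ∀ k ≤ m, w k = γ k}

lemma cyl_succ {d : ℕ} {P : Zd d → Measure (ℕ → Zd d)} (hP : IsSRW d P) (γ : ℕ → Zd d) (m : ℕ)
    (z : Zd d) : P (γ 0) (cyl (Function.update γ (m+1) z) (m+1)) ≤
      if adj z (γ m) then P (γ 0) (cyl γ m) * (2 * d : ℝ≥0∞)⁻¹ else 0 := by
  have h1 := hP.2 (γ 0) m γ rfl
  have h2 := hP.2 (γ 0) (m+1) (Function.update γ (m+1) z) (by simp [Function.update])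
  unfold cyl
  rw [h1, h2]
  by_cases hc : ∀ k < m + 1, adj (Function.update γ (m+1) z (k+1)) (Function.update γ (m+1) z k)
  · rw [if_pos hc]
    have a : adj z (γ m) := by
      have := hc m (by omega)
      simpa [Function.update] using this
    have b : ∀ k < m, adj (γ (k+1)) (γ k) := by
      intro k hk
      have := hc k (by omega)
      rwa [Function.update_of_ne (by omega), Function.update_of_ne (by omega)] at this
    rw [if_pos a, if_pos b, pow_succ]
  · rw [if_neg hc]; exact zero_le

lemma hit_bound {d : ℕ} (hd : 3 ≤ d) {P : Zd d → Measure (ℕ → Zd d)} (hP : IsSRW d P) (y : Zd d)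
    (N : ℕ) : ∀ (m : ℕ) (γ : ℕ → Zd d),
    P (γ 0) (cyl γ m ∩ {w | ∃ k, m ≤ k ∧ k ≤ m + N ∧ w k = y}) ≤
      P (γ 0) (cyl γ m) * ENNReal.ofReal (FF (γ m - y)) := by
  induction N with
  | zero =>
    intro m γ
    by_cases h : γ m = y
    · rw [h, sub_self, FF_zero]; simp only [ENNReal.ofReal_one, mul_one]
      exact measure_mono Set.inter_subset_left
    · have : cyl γ m ∩ {w | ∃ k, m ≤ k ∧ k ≤ m + 0 ∧ w k = y} = ∅ := by
        ext w
        simp only [Set.mem_inter_iff, Set.mem_ofPred_eq, Set.mem_empty_iff_false, iff_false]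
        rintro ⟨h1, k, h2, h3, h4⟩
        obtain rfl : k = m := by omega
        exact h ((h1 k le_rfl).symm.trans h4)
      rw [this]; simp
  | succ N ih =>
    intro m γ
    by_cases h : γ m = y
    · rw [h, sub_self, FF_zero]; simp only [ENNReal.ofReal_one, mul_one]
      exact measure_mono Set.inter_subset_left
    let g : Zd d → ℕ → Zd d := fun z => Function.update γ (m+1) z
    let E : Zd d → Set (ℕ → Zd d) := fun z =>
      cyl (g z) (m+1) ∩ {w | ∃ k, m + 1 ≤ k ∧ k ≤ m + 1 + N ∧ w k = y}
    have hg0 : ∀ z, g z 0 = γ 0 := fun z => by simp [g, Function.update]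
    have hgm : ∀ z, g z (m+1) = z := fun z => by simp [g]
    have hsub : cyl γ m ∩ {w | ∃ k, m ≤ k ∧ k ≤ m + (N+1) ∧ w k = y} ⊆
        (⋃ i : Fin d, (E (γ m + Pi.single i 1) ∪ E (γ m + Pi.single i (-1)))) ∪
        ⋃ z ∈ {z | ¬ adj z (γ m)}, cyl (g z) (m+1) := by
      rintro w ⟨h1, k, h2, h3, h4⟩
      have hw : w ∈ cyl (g (w (m+1))) (m+1) := by
        intro j hj
        by_cases hj' : j = m + 1
        · subst hj'; rw [hgm]
        · simp only [g]
          rw [Function.update_of_ne hj']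
          exact h1 j (by omega)
      have hk : k ≠ m := by
        rintro rfl
        exact h ((h1 k le_rfl).symm.trans h4)
      have hE : w ∈ E (w (m+1)) := ⟨hw, k, by omega, by omega, h4⟩
      by_cases ha : adj (w (m+1)) (γ m)
      · left
        obtain ⟨i, hi | hi⟩ := adj_cases ha
        · exact Set.mem_iUnion.2 ⟨i, Or.inl (hi ▸ hE)⟩
        · exact Set.mem_iUnion.2 ⟨i, Or.inr (hi ▸ hE)⟩
      · right
        exact Set.mem_biUnion (x := w (m+1)) ha hw
    have hnull : P (γ 0) (⋃ z ∈ {z | ¬ adj z (γ m)}, cyl (g z) (m+1)) = 0 := by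
      rw [measure_biUnion_null_iff (Set.to_countable _)]
      intro z hz
      have := cyl_succ hP γ m z
      rw [if_neg hz] at this
      exact le_antisymm this zero_le
    set p := P (γ 0) (cyl γ m) with hp
    have hE : ∀ z, P (γ 0) (E z) ≤ p * (2 * d : ℝ≥0∞)⁻¹ * ENNReal.ofReal (FF (z - y)) := by
      intro z
      have h1 := ih (m+1) (g z)
      rw [hg0, hgm] at h1
      refine h1.trans ?_
      gcongr
      refine (cyl_succ hP γ m z).trans ?_
      split_ifs
      · exact le_rfl
      · exact zero_le
    calc _ ≤ _ := measure_mono hsub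
      _ ≤ P (γ 0) (⋃ i : Fin d, (E (γ m + Pi.single i 1) ∪ E (γ m + Pi.single i (-1)))) + 0 := by
          rw [← hnull]; exact measure_union_le _ _
      _ ≤ ∑ i : Fin d, p * (2 * d : ℝ≥0∞)⁻¹ * ENNReal.ofReal
            (FF (γ m - y + Pi.single i 1) + FF (γ m - y + Pi.single i (-1))) := by
          rw [add_zero]
          refine (measure_iUnion_fintype_le _ _).trans ?_
          refine Finset.sum_le_sum fun i _ => ?_
          refine (measure_union_le _ _).trans ?_
          rw [ENNReal.ofReal_add (FF_nonneg _) (FF_nonneg _), mul_add]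
          refine add_le_add ((hE _).trans (le_of_eq ?_)) ((hE _).trans (le_of_eq ?_)) <;>
          rw [add_sub_right_comm]
      _ = p * (2 * d : ℝ≥0∞)⁻¹ * ENNReal.ofReal
            (∑ i : Fin d, (FF (γ m - y + Pi.single i 1) + FF (γ m - y + Pi.single i (-1)))) := by
          rw [← Finset.mul_sum, ENNReal.ofReal_sum_of_nonneg]
          intro i _
          exact add_nonneg (FF_nonneg _) (FF_nonneg _)
      _ ≤ p * (2 * d : ℝ≥0∞)⁻¹ * ENNReal.ofReal (2 * d * FF (γ m - y)) := by
          gcongr; exact FF_super hd _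
      _ = p * ((2 * d : ℝ≥0∞)⁻¹ * (2 * d)) * ENNReal.ofReal (FF (γ m - y)) := by
          rw [ENNReal.ofReal_mul (by positivity), ENNReal.ofReal_mul (by positivity)]
          simp only [ENNReal.ofReal_ofNat, ENNReal.ofReal_natCast]
          ring
      _ = _ := by
          rw [ENNReal.inv_mul_cancel, mul_one]
          · simp; omega
          · exact ENNReal.mul_ne_top (by simp) (by simp)

lemma hit_bound' {d : ℕ} (hd : 3 ≤ d) {P : Zd d → Measure (ℕ → Zd d)} (hP : IsSRW d P) (y : Zd d)
    (m : ℕ) (γ : ℕ → Zd d) :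
    P (γ 0) (cyl γ m ∩ {w | ∃ k, m ≤ k ∧ w k = y}) ≤
      P (γ 0) (cyl γ m) * ENNReal.ofReal (FF (γ m - y)) := by
  have : cyl γ m ∩ {w | ∃ k, m ≤ k ∧ w k = y} =
      ⋃ N, cyl γ m ∩ {w | ∃ k, m ≤ k ∧ k ≤ m + N ∧ w k = y} := by
    ext w
    simp only [Set.mem_inter_iff, Set.mem_ofPred_eq, Set.mem_iUnion]
    constructor
    · rintro ⟨h, k, hk, hy⟩
      exact ⟨k, h, k, hk, by omega, hy⟩
    · rintro ⟨_, h, k, hk, _, hy⟩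
      exact ⟨h, k, hk, hy⟩
  rw [this, Monotone.measure_iUnion]
  · exact iSup_le fun N => hit_bound hd hP y N m γ
  · intro a b hab w
    rintro ⟨h, k, hk, hk2, hy⟩
    exact ⟨h, k, hk, by omega, hy⟩

lemma esc_bound {d : ℕ} (hd : 3 ≤ d) {P : Zd d → Measure (ℕ → Zd d)} (hP : IsSRW d P)
    (K : Finset (Zd d)) (z e : Zd d) (R : ℕ) (he : ∀ v, adj (v + e) v)
    (hline : ∀ j : ℕ, 1 ≤ j → j ≤ R → z + j • e ∉ K)
    (hsum : ∑ y ∈ K, FF (z + R • e - y) ≤ 1 / 2) :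
    (2 * d : ℝ≥0∞)⁻¹ ^ R / 2 ≤ P z (escSet d K) := by
  set γ : ℕ → Zd d := fun j => z + j • e with hγ
  have h0 : γ 0 = z := by simp [hγ]
  have hC : P z (cyl γ R) = (2 * d : ℝ≥0∞)⁻¹ ^ R := by
    unfold cyl
    rw [hP.2 z R γ h0, if_pos]
    intro k _
    have := he (γ k)
    simp only [hγ] at this ⊢
    rwa [add_assoc, ← succ_nsmul] at this
  have hsub : cyl γ R ⊆ escSet d K ∪ ⋃ y ∈ K, (cyl γ R ∩ {w | ∃ k, R ≤ k ∧ w k = y}) := by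
    intro w hw
    by_cases hx : w ∈ escSet d K
    · exact Or.inl hx
    right
    simp only [escSet, Set.mem_ofPred_eq, not_forall, not_not] at hx
    obtain ⟨n, hn, hK⟩ := hx
    have : R ≤ n := by
      by_contra hlt
      have := hw n (by omega)
      rw [this] at hK
      exact hline n hn (by omega) hK
    exact Set.mem_biUnion (x := w n) hK ⟨hw, n, this, rfl⟩
  have h1 : P z (cyl γ R) ≤ P z (escSet d K) + P z (cyl γ R) / 2 := by
    calc _ ≤ _ := measure_mono hsub
      _ ≤ _ := measure_union_le _ _
      _ ≤ P z (escSet d K) + ∑ y ∈ K, P z (cyl γ R) * ENNReal.ofReal (FF (γ R - y)) := by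
          gcongr
          refine (measure_biUnion_finset_le _ _).trans ?_
          refine Finset.sum_le_sum fun y _ => ?_
          have := hit_bound' hd hP y R γ
          rwa [h0] at this
      _ ≤ _ := by
          gcongr
          rw [← Finset.mul_sum, ← ENNReal.ofReal_sum_of_nonneg (fun _ _ => FF_nonneg _),
            div_eq_mul_inv]
          gcongr
          calc _ ≤ ENNReal.ofReal (1/2) := ENNReal.ofReal_le_ofReal hsum
            _ = 2⁻¹ := by rw [one_div, ENNReal.ofReal_inv_of_pos (by norm_num)]; simp
  rw [← hC]
  have := hP.1 z
  have hfin : P z (cyl γ R) / 2 ≠ ⊤ := (ENNReal.div_lt_top (measure_ne_top _ _) (by norm_num)).ne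
  have h2 : P z (cyl γ R) / 2 + P z (cyl γ R) / 2 ≤ P z (escSet d K) + P z (cyl γ R) / 2 := by
    rwa [ENNReal.add_halves]
  exact (ENNReal.add_le_add_iff_right hfin).1 h2

end RI

namespace RI

def LL (n : ℕ) : ℤ := 2048 ^ n

lemma LL_cast (n : ℕ) : ((LL n : ℤ) : ℝ) = 2048 ^ n := by simp [LL]

noncomputable def box (d : ℕ) (r : ℤ) : Finset (Zd d) := Finset.Icc (fun _ => -r) (fun _ => r)

lemma mem_box {d : ℕ} {r : ℤ} (hr : 0 ≤ r) (z : Zd d) : z ∈ box d r ↔ ‖z‖ ≤ r := by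
  rw [pi_norm_le_iff_of_nonneg (by exact_mod_cast hr)]
  simp only [box, Finset.mem_Icc, Pi.le_def, Int.norm_eq_abs]
  constructor
  · rintro ⟨h1, h2⟩ i
    exact_mod_cast abs_le.2 ⟨h1 i, h2 i⟩
  · intro h
    have h' : ∀ i, |z i| ≤ r := fun i => by exact_mod_cast h i
    exact ⟨fun i => (abs_le.1 (h' i)).1, fun i => (abs_le.1 (h' i)).2⟩

noncomputable def pairs {d : ℕ} (n : ℕ) (x : Zd d) : Finset (Zd d × Zd d) :=
  @Finset.filter _ (fun p => 2 * (2048 : ℝ) ^ (n+1) - 2 * 2048 ^ n ≤ ‖p.1 - p.2‖) (Classical.decPred _)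
    ((box d 6146 ×ˢ box d 6146).image (fun p => (x + LL n • p.1, x + LL n • p.2)))

lemma pairs_card {d : ℕ} (n : ℕ) (x : Zd d) :
    (pairs n x).card ≤ (box d 6146 ×ˢ box d 6146).card :=
  (Finset.card_filter_le _ _).trans Finset.card_image_le

noncomputable def TT {d : ℕ} : ℕ → Zd d → Finset (Finset (Zd d))
  | 0, x => (box d 1).image (fun z => {x + z})
  | (n+1), x => (pairs n x).biUnion
      (fun p => ((TT n p.1) ×ˢ (TT n p.2)).image (fun q => q.1 ∪ q.2))

lemma TT_card {d : ℕ} (n : ℕ) (x : Zd d) :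
    (box d 6146 ×ˢ box d 6146).card * (TT n x).card ≤
      ((box d 6146 ×ˢ box d 6146).card * (box d 1).card) ^ (2 ^ n) := by
  induction n generalizing x with
  | zero =>
    simp only [pow_zero, pow_one]
    exact Nat.mul_le_mul_left _ Finset.card_image_le
  | succ n ih =>
    set M := (box d 6146 ×ˢ box d 6146).card with hM
    set Λ := M * (box d 1).card
    have h1 : M * (M * (TT (n+1) x).card) ≤ M * Λ ^ (2 ^ (n+1)) := by
      have : (TT (n+1) x).card ≤ ∑ p ∈ pairs n x, (TT n p.1).card * (TT n p.2).card := by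
        rw [TT]
        refine Finset.card_biUnion_le.trans (Finset.sum_le_sum fun p _ => ?_)
        exact Finset.card_image_le.trans (by rw [Finset.card_product])
      calc M * (M * (TT (n+1) x).card)
          ≤ M * (M * ∑ p ∈ pairs n x, (TT n p.1).card * (TT n p.2).card) := by gcongr
        _ = ∑ p ∈ pairs n x, (M * (TT n p.1).card) * (M * (TT n p.2).card) := by
            rw [Finset.mul_sum, Finset.mul_sum]
            exact Finset.sum_congr rfl fun p _ => by ring
        _ ≤ ∑ p ∈ pairs n x, Λ ^ (2 ^ n) * Λ ^ (2 ^ n) :=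
            Finset.sum_le_sum fun p _ => Nat.mul_le_mul (ih _) (ih _)
        _ = (pairs n x).card * Λ ^ (2 ^ (n+1)) := by
            rw [Finset.sum_const, smul_eq_mul, pow_succ 2 n, pow_mul Λ, _root_.sq]
        _ ≤ _ := Nat.mul_le_mul_right _ (pairs_card n x)
    rcases Nat.eq_zero_or_pos M with h0 | h0
    · rw [h0]; simp
    · exact Nat.le_of_mul_le_mul_left h1 h0

lemma smul_norm {d : ℕ} (l : ℤ) (i : Zd d) : ‖l • i‖ = |(l:ℝ)| * ‖i‖ := by
  rw [norm_smul, Int.norm_eq_abs]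

structure Good {d : ℕ} (n : ℕ) (x : Zd d) (K : Finset (Zd d)) : Prop where
  near : ∀ z ∈ K, ‖z - x‖ ≤ 4 * 2048 ^ n
  card : K.card = 2 ^ n
  sep : ∀ z ∈ K, ∀ y ∈ K, y ≠ z → 2048 ≤ ‖y - z‖
  sum : ∀ z ∈ K, ∀ p : Zd d, ‖p - z‖ ≤ 1024 →
    ∑ y ∈ K.erase z, FF (p - y) ≤ ∑ k ∈ Finset.range n, 2 ^ k * (4 / 32 ^ (k+1))

lemma good_half {d : ℕ} {n : ℕ} {x1 x2 : Zd d} {K1 K2 : Finset (Zd d)} (h1 : Good n x1 K1)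
    (h2 : Good n x2 K2) (hd : Disjoint K1 K2)
    (hs : ∀ y ∈ K1, ∀ y' ∈ K2, (2048:ℝ) ^ (n+1) ≤ ‖y - y'‖) :
    ∀ z ∈ K1, ∀ p : Zd d, ‖p - z‖ ≤ 1024 →
    ∑ y ∈ (K1 ∪ K2).erase z, FF (p - y) ≤ ∑ k ∈ Finset.range (n+1), 2 ^ k * (4 / 32 ^ (k+1)) := by
  intro z hz p hp
  have hz2 : z ∉ K2 := Finset.disjoint_left.1 hd hz
  rw [Finset.erase_union_distrib, Finset.erase_eq_of_notMem hz2,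
    Finset.sum_union (Finset.disjoint_of_subset_left (Finset.erase_subset _ _) hd),
    Finset.sum_range_succ]
  refine add_le_add (h1.sum z hz p hp) ?_
  calc _ ≤ ∑ y ∈ K2, (4 / 32 ^ (n+1) : ℝ) := by
        refine Finset.sum_le_sum fun y hy => FF_far _ _ ?_
        have a1 := hs z hz y hy
        have a2 : ‖z - y‖ ≤ ‖p - y‖ + ‖p - z‖ := by
          have := norm_sub_le (p - y) (p - z)
          rwa [sub_sub_sub_cancel_left] at this
        have a3 : (2048:ℝ) ^ (n+1) = 2 ^ (n+1) * 1024 ^ (n+1) := by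
          rw [← mul_pow]; norm_num
        have a4 : (2:ℝ) ≤ 2 ^ (n+1) := by
          rw [pow_succ]; linarith [one_le_pow₀ (M₀ := ℝ) (a := 2) (n := n) (by norm_num)]
        have a5 : (1024:ℝ) ≤ 1024 ^ (n+1) := by
          rw [pow_succ]; linarith [one_le_pow₀ (M₀ := ℝ) (a := 1024) (n := n) (by norm_num)]
        nlinarith
    _ = _ := by rw [Finset.sum_const, h2.card]; simp

lemma TT_good {d : ℕ} (n : ℕ) (x : Zd d) : ∀ K ∈ TT n x, Good n x K := by
  induction n generalizing x with
  | zero =>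
    intro K hK
    simp only [TT, Finset.mem_image] at hK
    obtain ⟨z, hz, rfl⟩ := hK
    rw [mem_box (by norm_num)] at hz
    refine ⟨?_, by simp, ?_, ?_⟩
    · intro y hy
      rw [Finset.mem_singleton] at hy
      subst hy
      simp only [add_sub_cancel_left, pow_zero]
      push_cast at hz; linarith
    · intro y hy y' hy' h
      simp at hy hy'
      exact absurd (hy'.trans hy.symm) h
    · intro y hy p _
      simp at hy
      subst hy
      simp
  | succ n ih =>
    intro K hK
    simp only [TT, Finset.mem_biUnion, Finset.mem_image, Finset.mem_product] at hK
    obtain ⟨⟨x1, x2⟩, hp, ⟨K1, K2⟩, ⟨hK1, hK2⟩, rfl⟩ := hK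
    simp only at hK1 hK2
    have g1 := ih x1 K1 hK1
    have g2 := ih x2 K2 hK2
    simp only [pairs, Finset.mem_filter, Finset.mem_image, Finset.mem_product] at hp
    obtain ⟨⟨⟨i, j⟩, ⟨hi, hj⟩, hij⟩, hsep⟩ := hp
    rw [mem_box (by norm_num)] at hi hj
    have hl : (1:ℝ) ≤ 2048 ^ n := one_le_pow₀ (by norm_num)
    have hL : (2048:ℝ) ^ (n+1) = 2048 * 2048 ^ n := by rw [pow_succ]; ring
    have n1 : ‖x1 - x‖ ≤ 6146 * 2048 ^ n := by
      have : x1 - x = LL n • i := by rw [← (Prod.mk.inj hij).1]; simp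
      rw [this, smul_norm, LL_cast, abs_of_pos (by positivity), mul_comm]
      push_cast at hi; gcongr
    have n2 : ‖x2 - x‖ ≤ 6146 * 2048 ^ n := by
      have : x2 - x = LL n • j := by rw [← (Prod.mk.inj hij).2]; simp
      rw [this, smul_norm, LL_cast, abs_of_pos (by positivity), mul_comm]
      push_cast at hj; gcongr
    have hs : ∀ y ∈ K1, ∀ y' ∈ K2, (2048:ℝ) ^ (n+1) ≤ ‖y - y'‖ := by
      intro y hy y' hy'
      have a1 := g1.near y hy
      have a2 := g2.near y' hy'
      have a3 : ‖x1 - x2‖ ≤ ‖y - y'‖ + ‖y - x1‖ + ‖y' - x2‖ := by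
        have : x1 - x2 = (y - y') - (y - x1) + (y' - x2) := by abel
        rw [this]
        exact (norm_add_le _ _).trans (add_le_add_left (norm_sub_le _ _) _)
      rw [hL] at hsep ⊢
      linarith
    have hs' : ∀ y ∈ K2, ∀ y' ∈ K1, (2048:ℝ) ^ (n+1) ≤ ‖y - y'‖ := by
      intro y hy y' hy'
      rw [norm_sub_rev]; exact hs y' hy' y hy
    have hdis : Disjoint K1 K2 := by
      rw [Finset.disjoint_left]
      intro y h1 h2
      have := hs y h1 y h2
      rw [sub_self, norm_zero] at this
      have : (0:ℝ) < 2048 ^ (n+1) := by positivity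
      linarith
    have hbig : (2048:ℝ) ≤ 2048 ^ (n+1) := by rw [hL]; linarith
    refine ⟨?_, ?_, ?_, ?_⟩
    · intro z hz
      rw [hL]
      rcases Finset.mem_union.1 hz with h | h
      · have := norm_sub_le_norm_sub_add_norm_sub z x1 x
        linarith [g1.near z h]
      · have := norm_sub_le_norm_sub_add_norm_sub z x2 x
        linarith [g2.near z h]
    · rw [Finset.card_union_of_disjoint hdis, g1.card, g2.card]; ring
    · intro z hz y hy hne
      rcases Finset.mem_union.1 hz with h | h <;> rcases Finset.mem_union.1 hy with h' | h'
      · exact g1.sep z h y h' hne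
      · exact hbig.trans (hs' y h' z h)
      · exact hbig.trans (hs y h' z h)
      · exact g2.sep z h y h' hne
    · intro z hz
      rcases Finset.mem_union.1 hz with h | h
      · exact good_half g1 g2 hdis hs z h
      · simp only
        rw [Finset.union_comm]
        exact good_half g2 g1 hdis.symm hs' z h

lemma geo_bound (n : ℕ) : ∑ k ∈ Finset.range n, (2:ℝ) ^ k * (4 / 32 ^ (k+1)) ≤ 2 / 15 := by
  have : ∑ k ∈ Finset.range n, (2:ℝ) ^ k * (4 / 32 ^ (k+1)) = 2 / 15 - 2/15 * (1/16) ^ n := by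
    induction n with
    | zero => simp
    | succ n ih =>
      rw [Finset.sum_range_succ, ih]
      have : (2:ℝ) ^ n * (4 / 32 ^ (n+1)) = 1/8 * (1/16) ^ n := by
        have : (1/16 : ℝ) ^ n = 2 ^ n / 32 ^ n := by rw [← div_pow]; norm_num
        rw [this, pow_succ]; field_simp; norm_num
      rw [this]; ring
  rw [this]
  have : (0:ℝ) ≤ (1/16) ^ n := by positivity
  linarith

lemma cap_bound {d : ℕ} (hd : 3 ≤ d) {P : Zd d → Measure (ℕ → Zd d)} (hP : IsSRW d P)
    (n : ℕ) (x : Zd d) (K : Finset (Zd d)) (hK : Good n x K) :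
    (2 ^ n : ℝ≥0∞) * ((2 * d : ℝ≥0∞)⁻¹ ^ 1024 / 2) ≤ capa d P K := by
  have i0 : Fin d := ⟨0, by omega⟩
  have : ∀ z ∈ K, (2 * d : ℝ≥0∞)⁻¹ ^ 1024 / 2 ≤ eqm d P K z := by
    intro z hz
    rw [eqm, if_pos hz]
    have hnorm : ∀ j : ℕ, ‖j • (Pi.single i0 1 : Zd d)‖ = j := by
      intro j
      rw [← natCast_zsmul, smul_norm, Pi.norm_single]
      simp
    refine esc_bound hd hP K z (Pi.single i0 1) 1024 (fun v => adj_single v i0) ?_ ?_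
    · intro j h1 h2 hmem
      have hn : ‖(z + j • (Pi.single i0 1 : Zd d)) - z‖ = j := by
        rw [add_sub_cancel_left, hnorm]
      have h1' : (1:ℝ) ≤ j := by exact_mod_cast h1
      have h2' : (j:ℝ) ≤ 1024 := by exact_mod_cast h2
      have := hK.sep z hz _ hmem (by
        intro he
        rw [he, sub_self, norm_zero] at hn
        linarith)
      linarith
    · have hn : ‖(z + 1024 • (Pi.single i0 1 : Zd d)) - z‖ = 1024 := by
        rw [add_sub_cancel_left, hnorm]; norm_num
      rw [← Finset.add_sum_erase _ _ hz]
      have b1 : FF (z + 1024 • (Pi.single i0 1 : Zd d) - z) ≤ 1 / 8 :=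
        (FF_far _ 1 (by rw [hn]; norm_num)).trans (by norm_num)
      have b2 := hK.sum z hz _ hn.le
      have b3 := geo_bound n
      linarith
  calc _ = ∑ z ∈ K, ((2 * d : ℝ≥0∞)⁻¹ ^ 1024 / 2) := by
        rw [Finset.sum_const, hK.card]; simp
    _ ≤ _ := Finset.sum_le_sum this

end RI

namespace RI

def Rel {d : ℕ} (S : Set (Zd d)) (a b : Zd d) : Prop := a ∈ S ∧ b ∈ S ∧ adj a b

def Conn {d : ℕ} (S : Set (Zd d)) (a b : Zd d) : Prop := a ∈ S ∧ Relation.ReflTransGen (Rel S) a b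

lemma Conn.symm {d : ℕ} {S : Set (Zd d)} {a b : Zd d} (h : Conn S a b) : Conn S b a := by
  obtain ⟨ha, h⟩ := h
  induction h with
  | refl => exact ⟨ha, .refl⟩
  | tail _ hbc ih => exact ⟨hbc.2.1, .head ⟨hbc.2.1, hbc.1, adj_symm hbc.2.2⟩ ih.2⟩

lemma conn_of {d : ℕ} {S : Set (Zd d)} {a b : Zd d} (h : connectedIn S a b) : Conn S a b := by
  obtain ⟨n, γ, rfl, rfl, h1, h2⟩ := h
  refine ⟨h1 0 (by omega), ?_⟩
  have : ∀ k ≤ n, Relation.ReflTransGen (Rel S) (γ 0) (γ k) := by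
    intro k
    induction k with
    | zero => intro _; exact .refl
    | succ k ih =>
      intro hk
      exact .tail (ih (by omega)) ⟨h1 k (by omega), h1 (k+1) hk, adj_symm (h2 k (by omega))⟩
  exact this n le_rfl

lemma ivt {d : ℕ} {S : Set (Zd d)} {a b x : Zd d} {m : ℝ} (h : Conn S a b) (ha : ‖a - x‖ < m)
    (hb : m ≤ ‖b - x‖) : ∃ b', Conn S a b' ∧ m ≤ ‖b' - x‖ ∧ ‖b' - x‖ ≤ m + 1 := by
  obtain ⟨hS, h⟩ := h
  induction h with
  | refl => linarith
  | @tail b c hab hbc ih =>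
    by_cases hm : m ≤ ‖b - x‖
    · exact ih hm
    · refine ⟨c, ⟨hS, hab.tail hbc⟩, hb, ?_⟩
      have h1 := adj_norm (adj_symm hbc.2.2)
      have h2 := norm_sub_le_norm_sub_add_norm_sub c b x
      push Not at hm
      linarith

def Cross {d : ℕ} (n : ℕ) (x : Zd d) (S : Set (Zd d)) : Prop :=
  ∃ a b, Conn S a b ∧ ‖a - x‖ ≤ 2048 ^ n ∧ 3 * 2048 ^ n ≤ ‖b - x‖

lemma round {d : ℕ} (n : ℕ) (x a : Zd d) (h : ‖a - x‖ ≤ 3 * 2048 ^ (n+1) + 1) :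
    ∃ i ∈ box d 6146, ‖a - (x + LL n • i)‖ ≤ 2048 ^ n := by
  have hl : (1:ℝ) ≤ 2048 ^ n := one_le_pow₀ (by norm_num)
  have hlp : (0:ℤ) < LL n := by unfold LL; positivity
  let i : Zd d := fun j => (a j - x j) / LL n
  have h1 : ‖a - (x + LL n • i)‖ ≤ 2048 ^ n := by
    rw [pi_norm_le_iff_of_nonneg (by positivity)]
    intro j
    rw [Int.norm_eq_abs, ← LL_cast]
    have e : (a - (x + LL n • i)) j = (a j - x j) % LL n := by
      have := Int.emod_def (a j - x j) (LL n)
      simp [i]; linarith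
    rw [e]
    have := Int.emod_nonneg (a j - x j) hlp.ne'
    have := Int.emod_lt_of_pos (a j - x j) hlp
    have : |(a j - x j) % LL n| ≤ LL n := abs_le.2 ⟨by omega, by omega⟩
    exact_mod_cast this
  refine ⟨i, ?_, h1⟩
  rw [mem_box (by norm_num)]
  have h2 : ‖LL n • i‖ ≤ 6146 * 2048 ^ n := by
    have : LL n • i = (a - x) - (a - (x + LL n • i)) := by abel
    rw [this]
    refine (norm_sub_le _ _).trans ?_
    rw [pow_succ] at h
    linarith
  rw [smul_norm, LL_cast, abs_of_pos (by positivity), mul_comm] at h2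
  push_cast
  exact le_of_mul_le_mul_right h2 (by positivity)

lemma cross_tree {d : ℕ} (S : Set (Zd d)) (n : ℕ) (x : Zd d) (h : Cross n x S) :
    ∃ K ∈ TT n x, ∀ z ∈ K, z ∈ S := by
  induction n generalizing x with
  | zero =>
    obtain ⟨a, b, hab, ha, _⟩ := h
    refine ⟨{a}, ?_, by simpa using hab.1⟩
    simp only [TT, Finset.mem_image]
    refine ⟨a - x, ?_, by simp⟩
    rw [mem_box (by norm_num)]
    simpa using ha
  | succ n ih =>
    obtain ⟨a, b, hab, ha, hb⟩ := h
    have hl : (1:ℝ) ≤ 2048 ^ n := one_le_pow₀ (by norm_num)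
    have hL : (2048:ℝ) ^ (n+1) = 2048 * 2048 ^ n := by rw [pow_succ]; ring
    obtain ⟨b', hab', hb1, hb2⟩ := ivt hab (by linarith) hb
    obtain ⟨i, hi, hi'⟩ := round n x a (by linarith)
    obtain ⟨j, hj, hj'⟩ := round n x b' hb2
    set x1 := x + LL n • i with hx1
    set x2 := x + LL n • j with hx2
    have hd : 2 * (2048:ℝ) ^ (n+1) ≤ ‖b' - a‖ := by
      have := norm_sub_le_norm_sub_add_norm_sub b' a x
      linarith
    obtain ⟨K1, hK1, hS1⟩ := ih x1 ⟨a, b', hab', hi', by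
      have := norm_sub_le_norm_sub_add_norm_sub b' x1 a
      rw [norm_sub_rev x1 a] at this
      rw [hL] at hd
      linarith⟩
    obtain ⟨K2, hK2, hS2⟩ := ih x2 ⟨b', a, hab'.symm, hj', by
      have := norm_sub_le_norm_sub_add_norm_sub a x2 b'
      rw [norm_sub_rev x2 b', norm_sub_rev a b'] at this
      rw [hL] at hd
      linarith⟩
    refine ⟨K1 ∪ K2, ?_, ?_⟩
    · simp only [TT, Finset.mem_biUnion, Finset.mem_image, Finset.mem_product]
      refine ⟨(x1, x2), ?_, (K1, K2), ⟨hK1, hK2⟩, rfl⟩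
      simp only [pairs, Finset.mem_filter, Finset.mem_image, Finset.mem_product]
      refine ⟨⟨(i, j), ⟨hi, hj⟩, rfl⟩, ?_⟩
      have : ‖b' - a‖ ≤ ‖x1 - x2‖ + ‖b' - x2‖ + ‖a - x1‖ := by
        have e : b' - a = (b' - x2) - (x1 - x2) - (a - x1) := by abel
        rw [e]
        have := norm_sub_le ((b' - x2) - (x1 - x2)) (a - x1)
        have := norm_sub_le (b' - x2) (x1 - x2)
        linarith
      linarith
    · intro z hz
      rcases Finset.mem_union.1 hz with h | h
      · exact hS1 z h
      · exact hS2 z h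

lemma cross_of_inf {d : ℕ} (S : Set (Zd d)) (n : ℕ) (x : Zd d)
    (h : {y : Zd d | connectedIn S x y}.Infinite) : Cross n x S := by
  by_contra hc
  apply h
  have hsub : {y : Zd d | connectedIn S x y} ⊆
      (fun z => x + z) '' (box d (3 * LL n) : Set (Zd d)) := by
    intro y hy
    refine ⟨y - x, ?_, by simp⟩
    have hl : (0:ℤ) ≤ 3 * LL n := by unfold LL; positivity
    rw [Finset.mem_coe, mem_box hl]
    by_contra hlt
    push_cast at hlt
    rw [LL_cast] at hlt
    push Not at hlt
    exact hc ⟨x, y, conn_of hy, by simp, hlt.le⟩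
  exact (Set.Finite.image _ (Finset.finite_toSet _)).subset hsub

lemma capa_ne_top {d : ℕ} {P : Zd d → Measure (ℕ → Zd d)} (hP : IsSRW d P) (K : Finset (Zd d)) :
    capa d P K ≠ ⊤ := by
  unfold capa
  rw [ENNReal.sum_ne_top]
  intro z hz
  have := hP.1 z
  rw [eqm, if_pos hz]
  exact measure_ne_top _ _

lemma Q_cross {d : ℕ} (hd : 3 ≤ d) {P : Zd d → Measure (ℕ → Zd d)} (hP : IsSRW d P) (u : ℝ)
    (hu : 0 ≤ u) (Q : Measure (Zd d → Bool)) (hQ : IsVacantLaw d P u Q) (n : ℕ) (x : Zd d)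
    (c : ℝ) (hc : ENNReal.ofReal c = (2 * d : ℝ≥0∞)⁻¹ ^ 1024 / 2) (hc0 : 0 < c) :
    Q {ω | Cross n x {z | ω z = true}} ≤
      ENNReal.ofReal (((TT n x).card : ℝ) * Real.exp (-(u * c)) ^ (2 ^ n)) := by
  have hsub : {ω : Zd d → Bool | Cross n x {z | ω z = true}} ⊆
      ⋃ K ∈ TT n x, {ω | ∀ z ∈ K, ω z = true} := by
    intro ω hω
    obtain ⟨K, hK, h⟩ := cross_tree _ n x hω
    exact Set.mem_biUnion (x := K) hK h
  refine (measure_mono hsub).trans ((measure_biUnion_finset_le _ _).trans ?_)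
  have : ∀ K ∈ TT n x, Q {ω | ∀ z ∈ K, ω z = true} ≤
      ENNReal.ofReal (Real.exp (-(u * c)) ^ (2 ^ n)) := by
    intro K hK
    rw [hQ.2 K]
    apply ENNReal.ofReal_le_ofReal
    rw [← Real.exp_nat_mul]
    apply Real.exp_le_exp.2
    have hb := cap_bound hd hP n x K (TT_good n x K hK)
    rw [← hc] at hb
    have h2 := ENNReal.toReal_mono (capa_ne_top hP K) hb
    rw [ENNReal.toReal_mul, ENNReal.toReal_ofReal hc0.le] at h2
    simp only [ENNReal.toReal_pow, ENNReal.toReal_ofNat] at h2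
    push_cast
    nlinarith
  refine (Finset.sum_le_sum this).trans (le_of_eq ?_)
  rw [Finset.sum_const, nsmul_eq_mul, ENNReal.ofReal_mul (by positivity), ENNReal.ofReal_natCast]

lemma main_bound {d : ℕ} (hd : 3 ≤ d) {P : Zd d → Measure (ℕ → Zd d)} (hP : IsSRW d P) :
    ∃ u0 : ℝ, 0 ≤ u0 ∧ ∀ u : ℝ, u0 ≤ u → ∀ Q : Measure (Zd d → Bool), IsVacantLaw d P u Q →
      ∀ x : Zd d, Q {ω | {y : Zd d | connectedIn {z | ω z = true} x y}.Infinite} = 0 := by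
  set c : ℝ := ((2 * d : ℝ≥0∞)⁻¹ ^ 1024 / 2).toReal with hcd
  have hne : (2 * d : ℝ≥0∞) ≠ 0 := by simp; omega
  have hnt : (2 * d : ℝ≥0∞) ≠ ⊤ := ENNReal.mul_ne_top (by simp) (by simp)
  have hfin : (2 * d : ℝ≥0∞)⁻¹ ^ 1024 / 2 ≠ ⊤ :=
    (ENNReal.div_lt_top (ENNReal.pow_ne_top (ENNReal.inv_ne_top.2 hne)) (by norm_num)).ne
  have hpos : (2 * d : ℝ≥0∞)⁻¹ ^ 1024 / 2 ≠ 0 :=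
    (ENNReal.div_pos (pow_ne_zero _ (ENNReal.inv_ne_zero.2 hnt)) (by norm_num)).ne'
  have hc : ENNReal.ofReal c = (2 * d : ℝ≥0∞)⁻¹ ^ 1024 / 2 := ENNReal.ofReal_toReal hfin
  have hc0 : 0 < c := ENNReal.toReal_pos hpos hfin
  clear_value c
  set M := (box d 6146 ×ˢ box d 6146).card with hM
  set Λ := M * (box d 1).card with hΛ
  have hbox : ∀ r : ℤ, 0 ≤ r → 0 < (box d r).card := fun r hr =>
    Finset.card_pos.2 ⟨0, by rw [mem_box hr]; simpa using hr⟩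
  have hM1 : 1 ≤ M := by
    rw [hM, Finset.card_product]
    exact Nat.mul_pos (hbox _ (by norm_num)) (hbox _ (by norm_num))
  have hΛ1 : 1 ≤ Λ := Nat.mul_pos hM1 (hbox _ (by norm_num))
  have hTT : ∀ n (x : Zd d), (TT n x).card ≤ Λ ^ (2 ^ n) := fun n x =>
    (Nat.le_mul_of_pos_left _ hM1).trans (TT_card n x)
  clear_value Λ
  have hΛr : (1:ℝ) ≤ Λ := by exact_mod_cast hΛ1
  refine ⟨Real.log (2 * Λ) / c, div_nonneg (Real.log_nonneg (by linarith)) hc0.le, ?_⟩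
  intro u hu Q hQ x
  have hu0 : 0 ≤ u := le_trans (div_nonneg (Real.log_nonneg (by linarith)) hc0.le) hu
  have hexp : Λ * Real.exp (-(u * c)) ≤ 1 / 2 := by
    rw [div_le_iff₀ hc0] at hu
    have h1 : 2 * (Λ:ℝ) ≤ Real.exp (u * c) := by
      rw [← Real.log_le_iff_le_exp (by linarith)]; exact hu
    rw [Real.exp_neg, ← div_eq_mul_inv, div_le_iff₀ (Real.exp_pos _)]
    linarith
  have hb : ∀ n : ℕ, Q {ω | {y : Zd d | connectedIn {z | ω z = true} x y}.Infinite} ≤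
      ENNReal.ofReal ((1/2) ^ n) := by
    intro n
    refine (measure_mono (t := {ω : Zd d → Bool | Cross n x {z | ω z = true}})
      fun ω hω => cross_of_inf _ n x hω).trans ?_
    refine (Q_cross hd hP u hu0 Q hQ n x c hc hc0).trans ?_
    apply ENNReal.ofReal_le_ofReal
    calc _ ≤ (Λ:ℝ) ^ (2 ^ n) * Real.exp (-(u * c)) ^ (2 ^ n) := by
          gcongr; exact_mod_cast hTT n x
      _ = (Λ * Real.exp (-(u * c))) ^ (2 ^ n) := by rw [mul_pow]
      _ ≤ (1/2) ^ (2 ^ n) := by gcongr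
      _ ≤ (1/2) ^ n := pow_le_pow_of_le_one (by norm_num) (by norm_num) Nat.lt_two_pow_self.le
  have hlim : Filter.Tendsto (fun n : ℕ => ENNReal.ofReal ((1/2 : ℝ) ^ n)) Filter.atTop
      (nhds 0) := by
    have := ENNReal.tendsto_ofReal
      (tendsto_pow_atTop_nhds_zero_of_lt_one (r := (1/2 : ℝ)) (by norm_num) (by norm_num))
    simpa using this
  exact le_antisymm (ge_of_tendsto' hlim hb) zero_le

end RI

/-- **Theorem 3.5: absence of percolation for large `u`.** There is `u∞ < ∞` such that
for every `u ≥ u∞` and every vacant-set law `Q` at level `u` the vacant set does not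
percolate; in particular (given vacant-set laws at all levels) the critical value
`u_* = inf{u ≥ 0 : η(u) = 0}` is finite, i.e. `{u ≥ 0 : η(u) = 0}` is nonempty. -/
theorem no_percolation_large_u
    (d : ℕ) (hd : 3 ≤ d) (P : Zd d → Measure (ℕ → Zd d)) (hP : IsSRW d P) :
    ∃ uInf : ℝ,
      (∀ u : ℝ, uInf ≤ u → ∀ Q : Measure (Zd d → Bool), IsVacantLaw d P u Q →
        Q {ω | ∃ x : Zd d, {y : Zd d | connectedIn {z | ω z = true} x y}.Infinite} = 0)
      ∧ ∀ Q : ℝ → Measure (Zd d → Bool),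
          (∀ u : ℝ, 0 ≤ u → IsVacantLaw d P u (Q u)) →
          {u : ℝ | 0 ≤ u ∧
            (Q u) {ω | {y : Zd d | connectedIn {z | ω z = true} (0 : Zd d) y}.Infinite}
              = 0}.Nonempty := by
  obtain ⟨u0, h0, h⟩ := RI.main_bound hd hP
  refine ⟨u0, ?_, ?_⟩
  · intro u hu Q hQ
    have : {ω : Zd d → Bool | ∃ x : Zd d, {y : Zd d | connectedIn {z | ω z = true} x y}.Infinite}
        = ⋃ x : Zd d, {ω | {y : Zd d | connectedIn {z | ω z = true} x y}.Infinite} := by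
      ext ω; simp
    rw [this, measure_iUnion_null_iff]
    exact h u hu Q hQ
  · intro Q hQ
    exact ⟨u0, h0, h u0 le_rfl (Q u0) (hQ u0 h0) 0⟩
end
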